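/- Fix n ≥ 1 and suppose that reg I^{i−1}/I^i + 2 ≤ reg I^i/I^{i+1} for all 1 ≤ i ≤ n−1, and that the same inequalities hold for J. Then reg R/(I+J)^n = max_{i+j = n−1, i,j ≥ 0} { reg I^i/I^{i+1} + reg J^j/J^{j+1} }, where I^i/I^{i+1} is regarded as an A-module and J^j/J^{j+1} as a B-module. -/

import Mathlib

/-! Core definitions: depth via local cohomology at the maximal homogeneous ideal,
Castelnuovo–Mumford regularity via graded free resolutions, gradings on
subquotients of polynomial rings.  -/

open MvPolynomial

noncomputable section

namespace PaperHTT

variable (k : Type) [Field k]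

/-- A polynomial is homogeneous of degree `e : ℤ` (it must vanish in negative degrees). -/
def homogZ {σ : Type} (p : MvPolynomial σ k) (e : ℤ) : Prop :=
  p = 0 ∨ (0 ≤ e ∧ p.IsHomogeneous e.toNat)

/-- The maximal homogeneous ideal `(x_1, …, x_r)` of a polynomial ring. -/
def maxHomIdeal (σ : Type) : Ideal (MvPolynomial σ k) :=
  Ideal.span (Set.range MvPolynomial.X)

/-- The depth of a module over a polynomial ring with respect to the maximal homogeneous
ideal: the least `i` such that the `i`-th local cohomology is non-vanishing. -/
def depthM {σ : Type} (M : ModuleCat (MvPolynomial σ k)) : ℕ :=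
  sInf {i : ℕ | Nontrivial ((localCohomology (maxHomIdeal k σ) i).obj M)}

/-- The subquotient `p/q` of a polynomial ring, for ideals `q ≤ p`. -/
abbrev subQuot {σ : Type} (p q : Ideal (MvPolynomial σ k)) : Type :=
  ↥p ⧸ (Submodule.comap p.subtype q)

/-- The degree-`t` graded piece of `p/q`: the image of the homogeneous elements of
degree `t` of `p`. -/
def subQuotGr {σ : Type} (p q : Ideal (MvPolynomial σ k)) (t : ℤ) :
    AddSubgroup (subQuot k p q) :=
  AddSubgroup.closure
    {x | ∃ f : p, homogZ k (f : MvPolynomial σ k) t ∧ x = Submodule.Quotient.mk f}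

/-- The degree-`t` graded piece of the quotient ring `P/Q`. -/
def quotGr {σ : Type} (Q : Ideal (MvPolynomial σ k)) (t : ℤ) :
    AddSubgroup (MvPolynomial σ k ⧸ Q) :=
  AddSubgroup.closure {x | ∃ f, homogZ k f t ∧ x = Ideal.Quotient.mk Q f}

/-- The degree-`t` graded piece of an ideal `p`, viewed as a module. -/
def idealGr {σ : Type} (p : Ideal (MvPolynomial σ k)) (t : ℤ) : AddSubgroup ↥p :=
  AddSubgroup.closure {x : p | homogZ k (x : MvPolynomial σ k) t}

/-- A finite graded free resolution of a module `M` over a polynomial ring,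
with respect to a grading `gr` of `M`: `F_i` is free of rank `rk i`, with basis elements
of (twisted) degrees `tw i l`, the differentials and augmentation are graded of degree `0`,
and the complex `⋯ → F_1 → F_0 → M → 0` is exact. -/
structure GradedFreeRes (σ : Type) (M : Type) [AddCommGroup M]
    [Module (MvPolynomial σ k) M] (gr : ℤ → AddSubgroup M) where
  rk : ℕ → ℕ
  tw : (i : ℕ) → Fin (rk i) → ℤ
  bdd : ∃ N, ∀ i, N ≤ i → rk i = 0
  aug : (Fin (rk 0) → MvPolynomial σ k) →ₗ[MvPolynomial σ k] M
  d : (i : ℕ) →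
    ((Fin (rk (i + 1)) → MvPolynomial σ k) →ₗ[MvPolynomial σ k]
      (Fin (rk i) → MvPolynomial σ k))
  aug_surj : Function.Surjective aug
  exact_zero : LinearMap.range (d 0) = LinearMap.ker aug
  exact_succ : ∀ i, LinearMap.range (d (i + 1)) = LinearMap.ker (d i)
  aug_homog : ∀ l, aug (Pi.single l 1) ∈ gr (tw 0 l)
  d_homog : ∀ i l l', homogZ k (d i (Pi.single l 1) l') (tw (i + 1) l - tw i l')

/-- The Castelnuovo–Mumford regularity of a (finitely generated) graded module over a
polynomial ring: the least `r` such that `M` admits a graded free resolution with all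
twists in homological degree `i` at most `r + i`.  (By minimal free resolutions, this
agrees with `max {aⁱ(M) + i}`.) -/
def regM (σ : Type) (M : Type) [AddCommGroup M] [Module (MvPolynomial σ k) M]
    (gr : ℤ → AddSubgroup M) : ℤ :=
  sInf {r : ℤ | ∃ F : GradedFreeRes k σ M gr, ∀ i (l : Fin (F.rk i)), F.tw i l - (i : ℤ) ≤ r}

/-- Depth of the quotient ring `P/Q` as a module over `P`. -/
def depthQuot {σ : Type} (Q : Ideal (MvPolynomial σ k)) : ℕ :=
  depthM k (ModuleCat.of (MvPolynomial σ k) (MvPolynomial σ k ⧸ Q))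

/-- Depth of the subquotient `p/q` as a module over the polynomial ring. -/
def depthSubQuot {σ : Type} (p q : Ideal (MvPolynomial σ k)) : ℕ :=
  depthM k (ModuleCat.of (MvPolynomial σ k) (subQuot k p q))

/-- Depth of an ideal `p` as a module over the polynomial ring. -/
def depthIdeal {σ : Type} (p : Ideal (MvPolynomial σ k)) : ℕ :=
  depthM k (ModuleCat.of (MvPolynomial σ k) ↥p)

/-- Regularity of the quotient ring `P/Q`. -/
def regQuot {σ : Type} (Q : Ideal (MvPolynomial σ k)) : ℤ :=
  regM k σ (MvPolynomial σ k ⧸ Q) (quotGr k Q)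

/-- Regularity of the subquotient `p/q`. -/
def regSubQuot {σ : Type} (p q : Ideal (MvPolynomial σ k)) : ℤ :=
  regM k σ (subQuot k p q) (subQuotGr k p q)

/-- Regularity of an ideal `p`, viewed as a graded module. -/
def regIdeal {σ : Type} (p : Ideal (MvPolynomial σ k)) : ℤ :=
  regM k σ (↥p) (idealGr k p)

/-- A homogeneous ideal: one containing all homogeneous components of its elements. -/
def IsHomogeneousIdeal {σ : Type} (I : Ideal (MvPolynomial σ k)) : Prop :=
  ∀ f ∈ I, ∀ m : ℕ, MvPolynomial.homogeneousComponent m f ∈ I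

/-- A monomial ideal. -/
def IsMonomialIdeal {σ : Type} (I : Ideal (MvPolynomial σ k)) : Prop :=
  ∃ S : Set (σ →₀ ℕ), I = Ideal.span ((fun a => MvPolynomial.monomial a (1 : k)) '' S)

/-- A squarefree monomial ideal. -/
def IsSquarefreeMonomialIdeal {σ : Type} (I : Ideal (MvPolynomial σ k)) : Prop :=
  ∃ S : Set (σ →₀ ℕ), (∀ a ∈ S, ∀ x, a x ≤ 1) ∧
    I = Ideal.span ((fun a => MvPolynomial.monomial a (1 : k)) '' S)


/-- The quotient ring `P/Q` is Cohen–Macaulay: its depth equals its Krull dimension. -/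
def IsCMQuot {σ : Type} (Q : Ideal (MvPolynomial σ k)) : Prop :=
  (depthQuot k Q : WithBot (WithTop ℕ)) = ringKrullDim (MvPolynomial σ k ⧸ Q)

/-- An isomorphism of graded modules: a linear isomorphism matching up the gradings. -/
def GradedIso {P : Type} [CommRing P] {M N : Type} [AddCommGroup M] [Module P M]
    [AddCommGroup N] [Module P N] (grM : ℤ → AddSubgroup M) (grN : ℤ → AddSubgroup N) :
    Prop :=
  ∃ e : M ≃ₗ[P] N, ∀ t, (grM t).map e.toLinearMap.toAddMonoidHom = grN t

/-- `gr` is an (internal, ℤ-) grading of the module `M` over a polynomial ring,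
compatible with the standard grading of the polynomial ring. -/
def IsGrading (σ : Type) {M : Type} [AddCommGroup M] [Module (MvPolynomial σ k) M]
    (gr : ℤ → AddSubgroup M) : Prop :=
  DirectSum.IsInternal (fun t : ℤ => gr t) ∧
    ∀ (p : MvPolynomial σ k) (d : ℕ) (t : ℤ) (m : M), p.IsHomogeneous d → m ∈ gr t →
      p • m ∈ gr (t + d)

/-- The polynomial ring `A = k[x_1,…,x_r]`. -/
abbrev PA (r : ℕ) : Type := MvPolynomial (Fin r) k

/-- The polynomial ring `B = k[y_1,…,y_s]`. -/
abbrev PB (s : ℕ) : Type := MvPolynomial (Fin s) k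

/-- The polynomial ring `R = k[x_1,…,x_r,y_1,…,y_s]`. -/
abbrev PR (r s : ℕ) : Type := MvPolynomial (Fin r ⊕ Fin s) k

/-- The extension of an ideal `I ⊆ A` to `R`. -/
def extA {r s : ℕ} (I : Ideal (PA k r)) : Ideal (PR k r s) :=
  I.map (MvPolynomial.rename (Sum.inl : Fin r → Fin r ⊕ Fin s))

/-- The extension of an ideal `J ⊆ B` to `R`. -/
def extB {r s : ℕ} (J : Ideal (PB k s)) : Ideal (PR k r s) :=
  J.map (MvPolynomial.rename (Sum.inr : Fin s → Fin r ⊕ Fin s))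

/-- The ideal `I + J ⊆ R`. -/
def sumIJ {r s : ℕ} (I : Ideal (PA k r)) (J : Ideal (PB k s)) : Ideal (PR k r s) :=
  extA k I + extB k J

end PaperHTT

end

namespace PaperHTT

noncomputable section

section LinearAlgebra

variable {k V W Z : Type*} [Field k] [AddCommGroup V] [Module k V] [AddCommGroup W] [Module k W]
  [AddCommGroup Z] [Module k Z]

/-- A linear map admits a linear section over the image of a subspace, with values in it. -/
theorem exists_section_on_map (f : V →ₗ[k] W) (F : Submodule k V) :
    ∃ g : W →ₗ[k] V, (∀ w, g w ∈ F) ∧ ∀ w ∈ F.map f, f (g w) = w := by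
  obtain ⟨g, hg⟩ := (f.domRestrict F).rangeRestrict.exists_rightInverse_of_surjective
    (LinearMap.range_rangeRestrict _)
  obtain ⟨g', hg'⟩ := g.exists_extend
  refine ⟨F.subtype ∘ₗ g', fun w => (g' w).2, fun w hw => ?_⟩
  have hw' : w ∈ LinearMap.range (f.domRestrict F) := by
    obtain ⟨v, hv, rfl⟩ := hw
    exact ⟨⟨v, hv⟩, rfl⟩
  have h1 : g' w = g ⟨w, hw'⟩ := by rw [← hg']; rfl
  have h2 := congrArg Subtype.val (LinearMap.congr_fun hg ⟨w, hw'⟩)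
  simpa [h1] using h2

/-- A projection onto a subspace. -/
theorem exists_projection (F : Submodule k V) :
    ∃ e : V →ₗ[k] V, (∀ v, e v ∈ F) ∧ ∀ v ∈ F, e v = v := by
  obtain ⟨e, h1, h2⟩ := exists_section_on_map (LinearMap.id : V →ₗ[k] V) F
  exact ⟨e, h1, fun v hv => h2 v (by simpa using hv)⟩

/-- A section over the image of a subspace which is compatible with a smaller subspace. -/
theorem exists_section_on_map_of_le (f : V →ₗ[k] W) {E F : Submodule k V} (hEF : E ≤ F) :
    ∃ g : W →ₗ[k] V, (∀ w, g w ∈ F) ∧ (∀ w ∈ E.map f, g w ∈ E) ∧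
      ∀ w ∈ F.map f, f (g w) = w := by
  obtain ⟨gE, hE1, hE2⟩ := exists_section_on_map f E
  obtain ⟨gF, hF1, hF2⟩ := exists_section_on_map f F
  obtain ⟨ρ, hρ1, hρ2⟩ := exists_projection (E.map f)
  have hle : E.map f ≤ F.map f := Submodule.map_mono hEF
  refine ⟨gE ∘ₗ ρ + gF ∘ₗ (LinearMap.id - ρ), fun w => ?_, fun w hw => ?_, fun w hw => ?_⟩
  · exact F.add_mem (hEF (hE1 _)) (hF1 _)
  · simpa [hρ2 w hw] using hE1 w
  · have h1 : f (gE (ρ w)) = ρ w := hE2 _ (hρ1 w)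
    have h2 : f (gF (w - ρ w)) = w - ρ w := hF2 _ (Submodule.sub_mem _ hw (hle (hρ1 w)))
    simp only [LinearMap.add_apply, LinearMap.comp_apply, LinearMap.sub_apply, LinearMap.id_apply,
      map_add, h1, h2]
    abel

/-- Over a field, a differential which is exact on a stable subspace `E` is contracted on `E`. -/
theorem exists_contraction (D : V →ₗ[k] V) (hDD : ∀ v, D (D v) = 0) {E F : Submodule k V}
    (hEF : E ≤ F)
    (hex : ∀ v ∈ E, D v = 0 → v ∈ F.map D) :
    ∃ h : V →ₗ[k] V, (∀ v, h v ∈ F) ∧ ∀ v ∈ E, D (h v) + h (D v) = v := by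
  obtain ⟨g, h1, h2, h3⟩ := exists_section_on_map_of_le D hEF
  refine ⟨g - g ∘ₗ g ∘ₗ D, fun v => F.sub_mem (h1 _) (h1 _), fun v hv => ?_⟩
  have a1 : D (g (D v)) = D v := h3 _ ⟨v, hEF hv, rfl⟩
  have a2 : g (D v) ∈ E := h2 _ ⟨v, hv, rfl⟩
  have a3 : D (g (v - g (D v))) = v - g (D v) :=
    h3 _ (hex _ (E.sub_mem hv a2) (by rw [map_sub, a1, sub_self]))
  simp only [LinearMap.sub_apply, LinearMap.comp_apply, map_sub, hDD, map_zero] at a3 ⊢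
  rw [sub_zero, a3]
  abel

/-- Relative version of `exists_contraction`: a differential on `F` which is exact modulo `F'` on
`E` is contracted on `E` modulo `F'`, by an operator which is odd for a given parity `e`. -/
theorem exists_odd_contraction (D e : V →ₗ[k] V) (hDD : ∀ v, D (D v) = 0)
    (hee : ∀ v, e (e v) = e v) (hDe : ∀ v, D (e v) = D v - e (D v)) {E F F' : Submodule k V}
    (hF' : F' ≤ F) (hEF : E ≤ F) (hDF' : ∀ v ∈ F', D v ∈ F')
    (heE : ∀ v ∈ E, e v ∈ E) (heF : ∀ v ∈ F, e v ∈ F) (heF' : ∀ v ∈ F', e v ∈ F')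
    (hex : ∀ v ∈ E, D v ∈ F' → ∃ w ∈ F, v - D w ∈ F') :
    ∃ h : V →ₗ[k] V, (∀ v, h (e v) = h v - e (h v)) ∧ (∀ v ∈ F, h v ∈ F) ∧
      (∀ v ∈ F', h v ∈ F') ∧ ∀ v ∈ E, v - (D (h v) + h (D v)) ∈ F' := by
  set D' : (V ⧸ F') →ₗ[k] (V ⧸ F') := F'.mapQ F' D hDF' with hD'
  have hD'q : ∀ v, D' (F'.mkQ v) = F'.mkQ (D v) := fun v => rfl
  obtain ⟨h', h1, h2⟩ := exists_contraction D' (E := E.map F'.mkQ) (F := F.map F'.mkQ)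
    (by
      intro v
      obtain ⟨v, rfl⟩ := F'.mkQ_surjective v
      rw [hD'q, hD'q, hDD, map_zero])
    (Submodule.map_mono hEF)
    (by
      rintro _ ⟨v, hv, rfl⟩ h0
      rw [hD'q, Submodule.mkQ_apply, Submodule.Quotient.mk_eq_zero] at h0
      obtain ⟨w, hw, hw'⟩ := hex v hv h0
      refine ⟨F'.mkQ w, ⟨w, hw, rfl⟩, ?_⟩
      rw [hD'q, eq_comm, ← sub_eq_zero, ← map_sub]
      exact (Submodule.Quotient.mk_eq_zero _).2 hw')
  obtain ⟨s, hs⟩ := F'.mkQ.exists_rightInverse_of_surjective (Submodule.range_mkQ _)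
  have hs' : ∀ v, F'.mkQ (s v) = v := fun v => LinearMap.congr_fun hs v
  set h0 : V →ₗ[k] V := s ∘ₗ h' ∘ₗ F'.mkQ with hh0
  have h0F : ∀ v, h0 v ∈ F := by
    intro v
    obtain ⟨w, hw, hw'⟩ := h1 (F'.mkQ v)
    have : F'.mkQ (h0 v - w) = 0 := by
      rw [map_sub, hw', hh0, LinearMap.comp_apply, LinearMap.comp_apply, hs', sub_self]
    have h3 : h0 v - w ∈ F' := (Submodule.Quotient.mk_eq_zero _).1 this
    simpa using F.add_mem (hF' h3) hw
  have h0F' : ∀ v ∈ F', h0 v = 0 := by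
    intro v hv
    have : F'.mkQ v = 0 := by simpa using hv
    rw [hh0, LinearMap.comp_apply, LinearMap.comp_apply, this, map_zero, map_zero]
  have h0E : ∀ v ∈ E, v - (D (h0 v) + h0 (D v)) ∈ F' := by
    intro v hv
    have : F'.mkQ (v - (D (h0 v) + h0 (D v))) = 0 := by
      rw [map_sub, map_add, ← hD'q, hh0]
      simp only [LinearMap.comp_apply, hs']
      rw [← hD'q, h2 _ ⟨v, hv, rfl⟩, sub_self]
    exact (Submodule.Quotient.mk_eq_zero _).1 this
  refine ⟨e ∘ₗ h0 ∘ₗ (LinearMap.id - e) + (LinearMap.id - e) ∘ₗ h0 ∘ₗ e, ?_, ?_, ?_, ?_⟩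
  · intro v
    simp only [LinearMap.add_apply, LinearMap.comp_apply, LinearMap.sub_apply, LinearMap.id_apply,
      map_sub, map_add, hee]
    abel
  · intro v hv
    exact F.add_mem (heF _ (h0F _)) (F.sub_mem (h0F _) (heF _ (h0F _)))
  · intro v hv
    simp only [LinearMap.add_apply, LinearMap.comp_apply, LinearMap.sub_apply, LinearMap.id_apply,
      map_sub, h0F' v hv, h0F' _ (heF' v hv), map_zero, sub_zero, add_zero]
    exact F'.zero_mem
  · intro v hv
    have a1 := heF' _ (h0E _ (heE v hv))
    have a2 := h0E _ (E.sub_mem hv (heE v hv))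
    convert F'.add_mem a1 (F'.sub_mem a2 (heF' _ a2)) using 1
    have hD1 : ∀ v, e (D v) = D v - D (e v) := fun v => by rw [hDe]; abel
    simp only [LinearMap.add_apply, LinearMap.comp_apply, LinearMap.sub_apply, LinearMap.id_apply,
      map_sub, map_add, hee, hD1]
    abel

/-- Relative Künneth vanishing: if `(F, F')` is exact on `E` and `(G, G')` is exact on `E'`, then
`(F ⊗ G, F' ⊗ G + F ⊗ G')` is exact on `E ⊗ G + F ⊗ E'`. -/
theorem relative_kunneth {μ : V →ₗ[k] W →ₗ[k] Z} (hμ : IsTensorProduct μ)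
    (D e : V →ₗ[k] V) (D' e' : W →ₗ[k] W) (Δ : Z →ₗ[k] Z)
    (hΔ : ∀ v w, Δ (μ v w) = μ (D v) w + μ (e v + e v - v) (D' w))
    (hDD : ∀ v, D (D v) = 0) (hee : ∀ v, e (e v) = e v) (hDe : ∀ v, D (e v) = D v - e (D v))
    (hDD' : ∀ v, D' (D' v) = 0) (hee' : ∀ v, e' (e' v) = e' v)
    (hDe' : ∀ v, D' (e' v) = D' v - e' (D' v))
    {E F F' : Submodule k V} {E' G G' : Submodule k W}
    (hF' : F' ≤ F) (hEF : E ≤ F) (hDF : ∀ v ∈ F, D v ∈ F) (hDF' : ∀ v ∈ F', D v ∈ F')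
    (heE : ∀ v ∈ E, e v ∈ E) (heF : ∀ v ∈ F, e v ∈ F) (heF' : ∀ v ∈ F', e v ∈ F')
    (hex : ∀ v ∈ E, D v ∈ F' → ∃ w ∈ F, v - D w ∈ F')
    (hG' : G' ≤ G) (hEG : E' ≤ G) (hDG : ∀ v ∈ G, D' v ∈ G) (hDG' : ∀ v ∈ G', D' v ∈ G')
    (heE' : ∀ v ∈ E', e' v ∈ E') (heG : ∀ v ∈ G, e' v ∈ G) (heG' : ∀ v ∈ G', e' v ∈ G')
    (hex' : ∀ v ∈ E', D' v ∈ G' → ∃ w ∈ G, v - D' w ∈ G')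
    (z : Z) (hz : z ∈ Submodule.map₂ μ E G ⊔ Submodule.map₂ μ F E')
    (hzD : Δ z ∈ Submodule.map₂ μ F' G ⊔ Submodule.map₂ μ F G') :
    ∃ y ∈ Submodule.map₂ μ F G,
      z - Δ y ∈ Submodule.map₂ μ F' G ⊔ Submodule.map₂ μ F G' := by
  obtain ⟨h, ho, hF, hFF, hc⟩ := exists_odd_contraction D e hDD hee hDe hF' hEF hDF' heE heF
    heF' hex
  obtain ⟨h', -, hG, hGG, hc'⟩ := exists_odd_contraction D' e' hDD' hee' hDe' hG' hEG hDG'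
    heE' heG heG' hex'
  set π : V →ₗ[k] V := LinearMap.id - (D ∘ₗ h + h ∘ₗ D) with hπ
  set π' : W →ₗ[k] W := LinearMap.id - (D' ∘ₗ h' + h' ∘ₗ D') with hπ'
  have πF : ∀ v ∈ F, π v ∈ F := fun v hv =>
    F.sub_mem hv (F.add_mem (hDF _ (hF _ hv)) (hF _ (hDF _ hv)))
  have πF' : ∀ v ∈ F', π v ∈ F' := fun v hv =>
    F'.sub_mem hv (F'.add_mem (hDF' _ (hFF _ hv)) (hFF _ (hDF' _ hv)))
  have πG : ∀ v ∈ G, π' v ∈ G := fun v hv =>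
    G.sub_mem hv (G.add_mem (hDG _ (hG _ hv)) (hG _ (hDG _ hv)))
  set ε : V →ₗ[k] V := e + e - LinearMap.id with hε
  have εF : ∀ v ∈ F, ε v ∈ F := fun v hv => F.sub_mem (F.add_mem (heF _ hv) (heF _ hv)) hv
  have εF' : ∀ v ∈ F', ε v ∈ F' := fun v hv =>
    F'.sub_mem (F'.add_mem (heF' _ hv) (heF' _ hv)) hv
  set H : Z →ₗ[k] Z := hμ.map hμ h LinearMap.id + hμ.map hμ (ε ∘ₗ π) h' with hH
  have Hμ : ∀ v w, H (μ v w) = μ (h v) w + μ (ε (π v)) (h' w) := by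
    intro v w
    simp [hH, IsTensorProduct.map_eq]
  have key : ∀ z, z = Δ (H z) + H (Δ z) + hμ.map hμ π π' z := by
    intro z
    induction z using hμ.inductionOn with
    | zero => simp
    | tmul v w =>
      have hΔ' : ∀ v w, Δ (μ v w) = μ (D v) w + μ (ε v) (D' w) := hΔ
      have hDe1 : ∀ v, e (D v) = D v - D (e v) := fun v => by rw [hDe]; abel
      have ho1 : ∀ v, e (h v) = h v - h (e v) := fun v => by rw [ho]; abel
      have c1 : ∀ v, ε (D v) = - D (ε v) := by
        intro v; simp only [hε, LinearMap.add_apply, LinearMap.sub_apply, LinearMap.id_apply,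
          map_sub, map_add, hDe1]; abel
      have c2 : ∀ v, ε (h v) = - h (ε v) := by
        intro v; simp only [hε, LinearMap.add_apply, LinearMap.sub_apply, LinearMap.id_apply,
          map_sub, map_add, ho1]; abel
      have c3 : ∀ v, ε (ε v) = v := by
        intro v; simp only [hε, LinearMap.add_apply, LinearMap.sub_apply, LinearMap.id_apply,
          map_sub, map_add, hee]; abel
      have πv : ∀ v, π v = v - (D (h v) + h (D v)) := fun v => rfl
      have πw : ∀ w, π' w = w - (D' (h' w) + h' (D' w)) := fun v => rfl
      have c4 : ∀ v, π (ε v) = ε (π v) := by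
        intro v; simp only [πv, map_sub, map_add, c1, c2, map_neg, neg_neg]
      have c5 : ∀ v, π (D v) = D (π v) := by
        intro v; simp only [πv, map_sub, map_add, hDD, map_zero]; abel
      simp only [Hμ, map_add, hΔ', IsTensorProduct.map_eq, c4, c5, c3, c1, c2, map_neg,
        LinearMap.neg_apply]
      rw [πw]
      simp only [map_sub, map_add]
      rw [πv]
      simp only [map_sub, map_add, LinearMap.sub_apply, LinearMap.add_apply]
      abel
    | add x y hx hy =>
      nth_rewrite 1 [hx, hy]
      simp only [map_add]; abel
  have HP : ∀ z ∈ Submodule.map₂ μ F G, H z ∈ Submodule.map₂ μ F G := by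
    intro z hz
    have : Submodule.map₂ μ F G ≤ (Submodule.map₂ μ F G).comap H :=
      Submodule.map₂_le.2 fun v hv w hw => by
        rw [Submodule.mem_comap, Hμ]
        exact Submodule.add_mem _ (Submodule.apply_mem_map₂ _ (hF _ hv) hw)
          (Submodule.apply_mem_map₂ _ (εF _ (πF _ hv)) (hG _ hw))
    exact this hz
  have HP' : Submodule.map₂ μ F' G ⊔ Submodule.map₂ μ F G' ≤
      (Submodule.map₂ μ F' G ⊔ Submodule.map₂ μ F G').comap H := by
    refine sup_le (Submodule.map₂_le.2 fun v hv w hw => ?_)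
      (Submodule.map₂_le.2 fun v hv w hw => ?_)
    · rw [Submodule.mem_comap, Hμ]
      exact Submodule.mem_sup_left (Submodule.add_mem _
        (Submodule.apply_mem_map₂ _ (hFF _ hv) hw)
          (Submodule.apply_mem_map₂ _ (εF' _ (πF' _ hv)) (hG _ hw)))
    · rw [Submodule.mem_comap, Hμ]
      exact Submodule.mem_sup_right (Submodule.add_mem _
        (Submodule.apply_mem_map₂ _ (hF _ hv) hw)
          (Submodule.apply_mem_map₂ _ (εF _ (πF _ hv)) (hGG _ hw)))
  have hPi : Submodule.map₂ μ E G ⊔ Submodule.map₂ μ F E' ≤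
      (Submodule.map₂ μ F' G ⊔ Submodule.map₂ μ F G').comap (hμ.map hμ π π') := by
    refine sup_le (Submodule.map₂_le.2 fun v hv w hw => ?_)
      (Submodule.map₂_le.2 fun v hv w hw => ?_)
    · rw [Submodule.mem_comap, IsTensorProduct.map_eq]
      exact Submodule.mem_sup_left (Submodule.apply_mem_map₂ _ (hc _ hv) (πG _ hw))
    · rw [Submodule.mem_comap, IsTensorProduct.map_eq]
      exact Submodule.mem_sup_right (Submodule.apply_mem_map₂ _ (πF _ hv) (hc' _ hw))
  have hle : Submodule.map₂ μ E G ⊔ Submodule.map₂ μ F E' ≤ Submodule.map₂ μ F G :=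
    sup_le (Submodule.map₂_le_map₂_left hEF) (Submodule.map₂_le_map₂_right hEG)
  refine ⟨H z, HP z (hle hz), ?_⟩
  have hz1 : z - Δ (H z) = H (Δ z) + hμ.map hμ π π' z := by
    nth_rewrite 1 [key z]; abel
  rw [hz1]
  exact Submodule.add_mem _ (HP' hzD) (hPi hz)

end LinearAlgebra

section Koszul

/-- The operator on `T → M` given by a square matrix of ring elements. -/
def matOp {P T : Type} [CommRing P] [Fintype T] (m : T → T → P) (M : Type) [AddCommGroup M]
    [Module P M] : (T → M) →ₗ[P] (T → M) where
  toFun f t := ∑ t', m t t' • f t'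
  map_add' f g := by ext t; simp [smul_add, Finset.sum_add_distrib]
  map_smul' a f := by ext t; simp [Finset.smul_sum, smul_comm a]

theorem matOp_apply {P T : Type} [CommRing P] [Fintype T] (m : T → T → P) (M : Type)
    [AddCommGroup M] [Module P M] (f : T → M) (t : T) :
    matOp m M f t = ∑ t', m t t' • f t' := rfl

/-- A Koszul complex on the variables of a polynomial ring: a free module on a finite graded set
`T` with a differential with linear entries, whose homology is the ground field, in degree `0`. -/
structure Koszul (k : Type) [Field k] (σ : Type) where
  T : Type
  [fintype : Fintype T]
  m : T → T → MvPolynomial σ k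
  deg : T → ℤ
  t0 : T
  deg_nonneg : ∀ t, 0 ≤ deg t
  deg_t0 : deg t0 = 0
  homog : ∀ t t', (m t t').IsHomogeneous 1
  deg_m : ∀ t t', m t t' ≠ 0 → deg t' = deg t + 1
  sq : ∀ f, matOp m (MvPolynomial σ k) (matOp m (MvPolynomial σ k) f) = 0
  acyc : ∀ f, matOp m (MvPolynomial σ k) f = 0 → constantCoeff (f t0) = 0 →
    ∃ g, matOp m (MvPolynomial σ k) g = f

attribute [instance] Koszul.fintype

variable {k : Type} [Field k] {σ τ : Type}

/-- The Koszul differential with coefficients in a module. -/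
def Koszul.D (K : Koszul k σ) (M : Type) [AddCommGroup M] [Module (MvPolynomial σ k) M] :
    (K.T → M) →ₗ[MvPolynomial σ k] (K.T → M) := matOp K.m M

theorem Koszul.D_apply (K : Koszul k σ) (M : Type) [AddCommGroup M]
    [Module (MvPolynomial σ k) M] (f : K.T → M) (t : K.T) :
    K.D M f t = ∑ t', K.m t t' • f t' := rfl

theorem Koszul.D_D (K : Koszul k σ) (M : Type) [AddCommGroup M]
    [Module (MvPolynomial σ k) M] (f : K.T → M) : K.D M (K.D M f) = 0 := by
  classical
  have h : ∀ t t'', ∑ t', K.m t t' * K.m t' t'' = 0 := by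
    intro t t''
    have := congrFun (K.sq (Pi.single t'' 1)) t
    simpa [matOp_apply, Pi.single_apply] using this
  ext t
  simp only [K.D_apply, Finset.smul_sum, smul_smul, Pi.zero_apply]
  rw [Finset.sum_comm]
  simp [← Finset.sum_smul, h]

theorem Koszul.D_comp (K : Koszul k σ) {M N : Type} [AddCommGroup M]
    [Module (MvPolynomial σ k) M] [AddCommGroup N] [Module (MvPolynomial σ k) N]
    (φ : M →ₗ[MvPolynomial σ k] N) (f : K.T → M) :
    K.D N (fun t => φ (f t)) = fun t => φ (K.D M f t) := by
  ext t
  simp [K.D_apply]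

/-- The projection to the part of even homological degree. -/
def Koszul.even (K : Koszul k σ) : (K.T → MvPolynomial σ k) →ₗ[k] (K.T → MvPolynomial σ k) where
  toFun f t := if Even (K.deg t) then f t else 0
  map_add' f g := by ext1 t; by_cases h : Even (K.deg t) <;> simp [h]
  map_smul' a f := by ext1 t; by_cases h : Even (K.deg t) <;> simp [h]

theorem Koszul.even_apply (K : Koszul k σ) (f : K.T → MvPolynomial σ k) (t : K.T) :
    K.even f t = if Even (K.deg t) then f t else 0 := rfl

theorem Koszul.even_even (K : Koszul k σ) (f : K.T → MvPolynomial σ k) :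
    K.even (K.even f) = K.even f := by
  ext1 t
  by_cases h : Even (K.deg t) <;> simp [K.even_apply, h]

theorem Koszul.D_even (K : Koszul k σ) (f : K.T → MvPolynomial σ k) :
    K.D _ (K.even f) = K.D _ f - K.even (K.D _ f) := by
  ext1 t
  simp only [K.D_apply, K.even_apply, Pi.sub_apply]
  by_cases h : Even (K.deg t)
  · rw [if_pos h, sub_self]
    refine Finset.sum_eq_zero fun t' _ => ?_
    by_cases h0 : K.m t t' = 0
    · simp [h0]
    · have := K.deg_m _ _ h0
      have h1 : ¬ Even (K.deg t') := by rw [this, Int.even_add_one]; simpa using h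
      simp [h1]
  · rw [if_neg h, sub_zero]
    refine Finset.sum_congr rfl fun t' _ => ?_
    by_cases h0 : K.m t t' = 0
    · simp [h0]
    · have := K.deg_m _ _ h0
      have h1 : Even (K.deg t') := by rw [this, Int.even_add_one]; simpa using h
      simp [h1]

/-- The exterior product of two families of polynomials in disjoint sets of variables. -/
def extMul (k : Type) [Field k] (σ τ S T : Type) :
    (S → MvPolynomial σ k) →ₗ[k] (T → MvPolynomial τ k) →ₗ[k]
      (S × T → MvPolynomial (σ ⊕ τ) k) :=
  LinearMap.mk₂ k (fun f g x => rename Sum.inl (f x.1) * rename Sum.inr (g x.2))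
    (fun f f' g => by ext1 x; simp [add_mul]) (fun a f g => by ext1 x; simp)
    (fun f g g' => by ext1 x; simp [mul_add]) (fun a f g => by ext1 x; simp)

theorem extMul_apply {S T : Type} (f : S → MvPolynomial σ k) (g : T → MvPolynomial τ k)
    (x : S × T) : extMul k σ τ S T f g x = rename Sum.inl (f x.1) * rename Sum.inr (g x.2) := rfl

theorem rename_inl_monomial_mul (a : σ →₀ ℕ) (b : τ →₀ ℕ) (c d : k) :
    rename Sum.inl (monomial a c) * rename Sum.inr (monomial b d) =
      monomial (Finsupp.sumFinsuppEquivProdFinsupp.symm (a, b)) (c * d) := by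
  have h : Finsupp.mapDomain Sum.inl a + Finsupp.mapDomain Sum.inr b =
      Finsupp.sumFinsuppEquivProdFinsupp.symm (a, b) := by
    ext (x | x)
    · rw [Finsupp.add_apply, Finsupp.mapDomain_apply Sum.inl_injective,
        Finsupp.mapDomain_of_notMem_range _ _ (by simp)]
      simp
    · rw [Finsupp.add_apply, Finsupp.mapDomain_apply Sum.inr_injective,
        Finsupp.mapDomain_of_notMem_range _ _ (by simp)]
      simp
  rw [rename_monomial, rename_monomial, monomial_mul, h]

/-- The index bijection between the monomial bases in `isTensorProduct_extMul`. -/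
def extMulIndex (σ τ S T : Type) :
    ((_ : S) × (σ →₀ ℕ)) × ((_ : T) × (τ →₀ ℕ)) ≃ (_ : S × T) × (σ ⊕ τ →₀ ℕ) where
  toFun x := ⟨(x.1.1, x.2.1), Finsupp.sumFinsuppEquivProdFinsupp.symm (x.1.2, x.2.2)⟩
  invFun y := (⟨y.1.1, (Finsupp.sumFinsuppEquivProdFinsupp y.2).1⟩,
    ⟨y.1.2, (Finsupp.sumFinsuppEquivProdFinsupp y.2).2⟩)
  left_inv x := by simp
  right_inv y := by simp

theorem isTensorProduct_extMul (k : Type) [Field k] (σ τ S T : Type) [Fintype S] [Fintype T] :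
    IsTensorProduct (extMul k σ τ S T) := by
  classical
  let bA := Pi.basis fun _ : S => basisMonomials σ k
  let bB := Pi.basis fun _ : T => basisMonomials τ k
  let bZ := Pi.basis fun _ : S × T => basisMonomials (σ ⊕ τ) k
  let e := (bA.tensorProduct bB).equiv bZ (extMulIndex σ τ S T)
  have h : TensorProduct.lift (extMul k σ τ S T) = e.toLinearMap := by
    refine (bA.tensorProduct bB).ext fun x => ?_
    rw [LinearEquiv.coe_coe, Module.Basis.equiv_apply, Module.Basis.tensorProduct_apply,
      TensorProduct.lift.tmul]
    obtain ⟨⟨s, a⟩, ⟨t, b⟩⟩ := x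
    ext1 y
    obtain ⟨s', t'⟩ := y
    simp only [bA, bB, bZ, Pi.basis_apply, extMul_apply, basisMonomials, extMulIndex,
      Equiv.coe_fn_mk, Module.Basis.coe_ofRepr, Pi.single_apply]
    by_cases hs : s' = s
    · by_cases ht : t' = t
      · subst hs ht
        have h1 := rename_inl_monomial_mul a b (1 : k) 1
        simp only [mul_one] at h1
        simp only
        exact h1
      · simp [ht]
    · simp [hs]
  rw [IsTensorProduct, h]
  exact e.bijective

end Koszul

section KoszulProd
variable {k : Type} [Field k] {σ τ : Type}

open scoped Classical in
/-- The matrix of the differential of the tensor product of two Koszul complexes. -/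
def Koszul.prodM (K : Koszul k σ) (L : Koszul k τ) (x y : K.T × L.T) :
    MvPolynomial (σ ⊕ τ) k :=
  (if x.2 = y.2 then rename Sum.inl (K.m x.1 y.1) else 0) +
    (if x.1 = y.1 then (if Even (K.deg x.1) then rename Sum.inr (L.m x.2 y.2)
      else - rename Sum.inr (L.m x.2 y.2)) else 0)

theorem Koszul.prodM_extMul (K : Koszul k σ) (L : Koszul k τ) (f : K.T → MvPolynomial σ k)
    (g : L.T → MvPolynomial τ k) :
    matOp (K.prodM L) _ (extMul k σ τ K.T L.T f g) =
      extMul k σ τ K.T L.T (K.D _ f) g +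
        extMul k σ τ K.T L.T (K.even f + K.even f - f) (L.D _ g) := by
  classical
  ext1 ⟨s, t⟩
  rw [Pi.add_apply, extMul_apply, extMul_apply]
  simp only [matOp_apply, prodM, Fintype.sum_prod_type, extMul_apply, smul_eq_mul, add_mul,
    ite_mul, zero_mul, Finset.sum_add_distrib, K.D_apply, L.D_apply, map_sum, map_mul,
    Finset.sum_mul]
  congr 1
  · refine Finset.sum_congr rfl fun s' _ => ?_
    rw [Finset.sum_ite_eq]
    simp [mul_assoc]
  · rw [Finset.mul_sum, Finset.sum_eq_single s]
    · refine Finset.sum_congr rfl fun t' _ => ?_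
      by_cases h : Even (K.deg s)
      · simp only [Pi.sub_apply, Pi.add_apply, K.even_apply, h, if_true, map_add, map_sub]
        ring
      · simp only [Pi.sub_apply, Pi.add_apply, K.even_apply, h, if_true, if_false, map_add,
          map_sub, map_zero]
        ring
    · intro s' _ h
      simp [Ne.symm h]
    · simp

theorem Koszul.even_linear_relation (K : Koszul k σ) (f : K.T → MvPolynomial σ k) :
    K.D _ (K.even f + K.even f - f) =
      -(K.even (K.D _ f) + K.even (K.D _ f) - K.D _ f) := by
  rw [map_sub, map_add, K.D_even]
  abel

theorem Koszul.prodM_prodM (K : Koszul k σ) (L : Koszul k τ)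
    (z : K.T × L.T → MvPolynomial (σ ⊕ τ) k) :
    matOp (K.prodM L) _ (matOp (K.prodM L) _ z) = 0 := by
  induction z using (isTensorProduct_extMul k σ τ K.T L.T).inductionOn with
  | zero => simp
  | tmul f g =>
    rw [K.prodM_extMul, map_add, K.prodM_extMul, K.prodM_extMul, K.even_linear_relation,
      K.D_D, L.D_D]
    simp
  | add x y hx hy => rw [map_add, map_add, hx, hy, add_zero]

/-- The families of polynomials whose entry in homological degree zero vanishes at the origin. -/
def Koszul.aug (K : Koszul k σ) : Submodule k (K.T → MvPolynomial σ k) where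
  carrier := {f | constantCoeff (f K.t0) = 0}
  add_mem' {f g} hf hg := by
    simp only [Set.mem_ofPred_eq, Pi.add_apply, map_add] at *
    rw [hf, hg, add_zero]
  zero_mem' := by simp
  smul_mem' a f hf := by
    simp only [Set.mem_ofPred_eq, Pi.smul_apply, constantCoeff_smul] at *
    rw [hf, smul_zero]

theorem Koszul.mem_aug (K : Koszul k σ) (f : K.T → MvPolynomial σ k) :
    f ∈ K.aug ↔ constantCoeff (f K.t0) = 0 := Iff.rfl

theorem Koszul.even_mem_aug (K : Koszul k σ) (f : K.T → MvPolynomial σ k) (hf : f ∈ K.aug) :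
    K.even f ∈ K.aug := by
  rw [mem_aug] at *
  rw [K.even_apply, K.deg_t0, if_pos (by simp), hf]

open scoped Classical in
/-- The generator in homological degree zero. -/
def Koszul.unit (K : Koszul k σ) : K.T → MvPolynomial σ k := Pi.single K.t0 1

theorem Koszul.sub_smul_unit_mem (K : Koszul k σ) (f : K.T → MvPolynomial σ k) :
    f - constantCoeff (f K.t0) • K.unit ∈ K.aug := by
  classical
  simp [mem_aug, unit, constantCoeff_smul]

theorem Koszul.mem_map₂_of_constantCoeff (K : Koszul k σ) (L : Koszul k τ)
    (z : K.T × L.T → MvPolynomial (σ ⊕ τ) k) :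
    z - constantCoeff (z (K.t0, L.t0)) • extMul k σ τ K.T L.T K.unit L.unit ∈
      Submodule.map₂ (extMul k σ τ K.T L.T) K.aug ⊤ ⊔
        Submodule.map₂ (extMul k σ τ K.T L.T) ⊤ L.aug := by
  induction z using (isTensorProduct_extMul k σ τ K.T L.T).inductionOn with
  | zero => simp
  | tmul f g =>
    have h1 := Submodule.apply_mem_map₂ (extMul k σ τ K.T L.T) (K.sub_smul_unit_mem f)
      (Submodule.mem_top : g ∈ ⊤)
    have h2 := Submodule.apply_mem_map₂ (extMul k σ τ K.T L.T)
      (Submodule.mem_top : constantCoeff (f K.t0) • K.unit ∈ ⊤) (L.sub_smul_unit_mem g)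
    convert Submodule.add_mem_sup h1 h2 using 1
    have h3 : constantCoeff (extMul k σ τ K.T L.T f g (K.t0, L.t0)) =
        constantCoeff (f K.t0) * constantCoeff (g L.t0) := by
      simp [extMul_apply, constantCoeff_rename]
    rw [h3]
    simp only [map_sub, map_smul, LinearMap.sub_apply, LinearMap.smul_apply, mul_smul]
    abel_nf
    simp [smul_smul, mul_comm]
  | add x y hx hy =>
    convert add_mem hx hy using 1
    simp only [Pi.add_apply, map_add, add_smul]
    abel

/-- The tensor product of two Koszul complexes. -/
def Koszul.prod (K : Koszul k σ) (L : Koszul k τ) : Koszul k (σ ⊕ τ) where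
  T := K.T × L.T
  m := K.prodM L
  deg x := K.deg x.1 + L.deg x.2
  t0 := (K.t0, L.t0)
  deg_nonneg x := add_nonneg (K.deg_nonneg _) (L.deg_nonneg _)
  deg_t0 := by simp [K.deg_t0, L.deg_t0]
  homog x y := by
    unfold Koszul.prodM
    refine IsHomogeneous.add ?_ ?_
    · split_ifs
      · exact (K.homog _ _).rename_isHomogeneous
      · exact isHomogeneous_zero _ _ _
    · split_ifs
      · exact (L.homog _ _).rename_isHomogeneous
      · exact (L.homog _ _).rename_isHomogeneous.neg
      · exact isHomogeneous_zero _ _ _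
  deg_m x y h := by
    unfold Koszul.prodM at h
    by_cases h2 : x.2 = y.2 ∧ K.m x.1 y.1 ≠ 0
    · rw [K.deg_m _ _ h2.2, h2.1]; ring
    · have h3 : x.1 = y.1 ∧ L.m x.2 y.2 ≠ 0 := by
        by_contra h3
        apply h
        rw [not_and_or, not_not] at h2 h3
        rcases h2 with h2 | h2 <;> rcases h3 with h3 | h3 <;> simp [h2, h3]
      rw [L.deg_m _ _ h3.2, h3.1]; ring
  sq := K.prodM_prodM L
  acyc f hf h0 := by
    have h1 := K.mem_map₂_of_constantCoeff L f
    rw [h0, zero_smul, sub_zero] at h1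
    obtain ⟨y, -, hy⟩ := relative_kunneth (isTensorProduct_extMul k σ τ K.T L.T)
      ((K.D (MvPolynomial σ k)).restrictScalars k) K.even
      ((L.D (MvPolynomial τ k)).restrictScalars k) L.even
      ((matOp (K.prodM L) (MvPolynomial (σ ⊕ τ) k)).restrictScalars k)
      (K.prodM_extMul L) (K.D_D _) K.even_even K.D_even (L.D_D _) L.even_even L.D_even
      (E := K.aug) (F := ⊤) (F' := ⊥) (E' := L.aug) (G := ⊤) (G' := ⊥)
      bot_le le_top (by simp) (by simp) K.even_mem_aug (by simp) (by simp)
      (fun v hv hDv => by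
        obtain ⟨g, hg⟩ := K.acyc v ((Submodule.mem_bot _).1 hDv) hv
        exact ⟨g, trivial, by rw [Submodule.mem_bot, sub_eq_zero]; exact hg.symm⟩)
      bot_le le_top (by simp) (by simp) L.even_mem_aug (by simp) (by simp)
      (fun v hv hDv => by
        obtain ⟨g, hg⟩ := L.acyc v ((Submodule.mem_bot _).1 hDv) hv
        exact ⟨g, trivial, by rw [Submodule.mem_bot, sub_eq_zero]; exact hg.symm⟩)
      f h1 (by simp [hf])
    refine ⟨y, ?_⟩
    simp only [Submodule.map₂_bot_left, Submodule.map₂_bot_right, sup_idem, Submodule.mem_bot,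
      sub_eq_zero] at hy
    exact hy.symm

theorem Koszul.prod_D_extMul (K : Koszul k σ) (L : Koszul k τ) (f : K.T → MvPolynomial σ k)
    (g : L.T → MvPolynomial τ k) :
    (K.prod L).D _ (extMul k σ τ K.T L.T f g) =
      extMul k σ τ K.T L.T (K.D _ f) g +
        extMul k σ τ K.T L.T (K.even f + K.even f - f) (L.D _ g) :=
  K.prodM_extMul L f g

/-- The Koszul complex in no variables. -/
def Koszul.empty (k : Type) [Field k] : Koszul k (Fin 0) where
  T := Unit
  m _ _ := 0
  deg _ := 0
  t0 := ()
  deg_nonneg _ := le_rfl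
  deg_t0 := rfl
  homog _ _ := isHomogeneous_zero _ _ _
  deg_m _ _ h := absurd rfl h
  sq f := by ext1 t; simp [matOp_apply]
  acyc f _ h := by
    refine ⟨0, ?_⟩
    ext1 t
    rw [map_zero, Pi.zero_apply, eq_C_of_isEmpty (f t), ← constantCoeff_eq]
    rw [show t = () from rfl, h, C_0]

theorem exists_eq_C_add_X_mul (f : MvPolynomial (Fin 1) k) :
    ∃ g, f = C (constantCoeff f) + X 0 * g := by
  induction f using MvPolynomial.induction_on with
  | C a => exact ⟨0, by simp⟩
  | add p q hp hq =>
    obtain ⟨g, hg⟩ := hp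
    obtain ⟨h, hh⟩ := hq
    refine ⟨g + h, ?_⟩
    nth_rw 1 [hg, hh]
    rw [map_add, C_add]
    ring
  | mul_X p i hp =>
    refine ⟨p, ?_⟩
    rw [Subsingleton.elim i 0]
    simp [mul_comm]

/-- The Koszul complex in one variable. -/
def Koszul.one (k : Type) [Field k] : Koszul k (Fin 1) where
  T := Bool
  m t t' := if t = false ∧ t' = true then X 0 else 0
  deg t := if t then 1 else 0
  t0 := false
  deg_nonneg t := by split_ifs <;> simp
  deg_t0 := rfl
  homog t t' := by
    split_ifs
    · exact isHomogeneous_X _ _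
    · exact isHomogeneous_zero _ _ _
  deg_m t t' h := by
    cases t <;> cases t' <;> simp at h ⊢
  sq f := by ext1 t; cases t <;> simp [matOp_apply]
  acyc f hf h := by
    have h1 : f true = 0 := by
      have := congrFun hf false
      simpa [matOp_apply] using this
    obtain ⟨g, hg⟩ := exists_eq_C_add_X_mul (f false)
    rw [h, C_0, zero_add] at hg
    refine ⟨fun _ => g, ?_⟩
    ext1 t
    cases t
    · simp [matOp_apply, hg]
    · simp [matOp_apply, h1]

/-- Renaming the variables of a Koszul complex. -/
def Koszul.congr (K : Koszul k σ) (e : σ ≃ τ) : Koszul k τ := by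
  have key : ∀ f : K.T → MvPolynomial σ k,
      matOp (fun t t' => rename e (K.m t t')) (MvPolynomial τ k) (fun t => rename e (f t)) =
        fun t => rename e (matOp K.m _ f t) := by
    intro f
    ext1 t
    simp [matOp_apply]
  have surj : ∀ f : K.T → MvPolynomial τ k, ∃ g : K.T → MvPolynomial σ k,
      (fun t => rename e (g t)) = f := fun f =>
    ⟨fun t => rename e.symm (f t), by ext1 t; simp [rename_rename]⟩
  exact
  { T := K.T
    m := fun t t' => rename e (K.m t t')
    deg := K.deg
    t0 := K.t0
    deg_nonneg := K.deg_nonneg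
    deg_t0 := K.deg_t0
    homog := fun t t' => (K.homog t t').rename_isHomogeneous
    deg_m := fun t t' h => K.deg_m t t' fun h0 => h (by rw [h0, map_zero])
    sq := fun f => by
      obtain ⟨g, rfl⟩ := surj f
      rw [key, key, K.sq]
      ext1 t
      simp
    acyc := fun f hf h => by
      obtain ⟨g, rfl⟩ := surj f
      rw [key] at hf
      obtain ⟨y, hy⟩ := K.acyc g
        (by ext1 t; exact rename_injective e e.injective ((congrFun hf t).trans (by simp)))
        (by simpa [constantCoeff_rename] using h)
      exact ⟨fun t => rename e (y t), by rw [key, hy]⟩ }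

theorem nonempty_koszul (k : Type) [Field k] (n : ℕ) : Nonempty (Koszul k (Fin n)) := by
  induction n with
  | zero => exact ⟨Koszul.empty k⟩
  | succ n ih =>
    obtain ⟨K⟩ := ih
    exact ⟨(K.prod (Koszul.one k)).congr finSumFinEquiv⟩

end KoszulProd

section Graded
variable {k : Type} [Field k] {σ : Type}

/-- The homogeneous component of a polynomial in an integral degree. -/
def compZ (k : Type) [Field k] {σ : Type} (j : ℤ) : MvPolynomial σ k →ₗ[k] MvPolynomial σ k :=
  if 0 ≤ j then homogeneousComponent j.toNat else 0

theorem coeff_compZ (j : ℤ) (p : MvPolynomial σ k) (a : σ →₀ ℕ) :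
    coeff a (compZ k j p) = if (a.degree : ℤ) = j then coeff a p else 0 := by
  unfold compZ
  by_cases h : 0 ≤ j
  · rw [if_pos h, coeff_homogeneousComponent]
    obtain ⟨n, rfl⟩ := Int.eq_ofNat_of_zero_le h
    simp
  · rw [if_neg h, if_neg (by omega)]
    simp

theorem compZ_compZ (i j : ℤ) (p : MvPolynomial σ k) :
    compZ k i (compZ k j p) = if i = j then compZ k j p else 0 := by
  ext a
  split_ifs with h
  · subst h
    simp only [coeff_compZ]
    split_ifs <;> rfl
  · simp only [coeff_compZ, coeff_zero]
    split_ifs with h1 h2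
    · omega
    · rfl
    · rfl

theorem homogZ_iff (p : MvPolynomial σ k) (e : ℤ) : homogZ k p e ↔ compZ k e p = p := by
  constructor
  · rintro (h | ⟨h0, h⟩)
    · simp [h]
    · unfold compZ
      rw [if_pos h0, homogeneousComponent_eq_self h]
  · intro h
    unfold compZ at h
    split_ifs at h with h0
    · right
      refine ⟨h0, ?_⟩
      rw [← h]
      exact homogeneousComponent_isHomogeneous _ _
    · left
      simpa using h.symm

theorem compZ_of_isHomogeneous {p : MvPolynomial σ k} {n : ℕ} (h : p.IsHomogeneous n) (j : ℤ) :
    compZ k j p = if j = n then p else 0 := by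
  have h1 : compZ k n p = p := (homogZ_iff p n).1 (Or.inr ⟨by omega, by simpa using h⟩)
  rw [← h1, compZ_compZ]

theorem compZ_of_neg {j : ℤ} (hj : j < 0) (p : MvPolynomial σ k) : compZ k j p = 0 := by
  unfold compZ
  rw [if_neg (by omega)]
  rfl

theorem compZ_mul {p : MvPolynomial σ k} {n : ℕ} (h : p.IsHomogeneous n) (i : ℤ)
    (q : MvPolynomial σ k) : compZ k (i + n) (p * q) = p * compZ k i q := by
  induction q using MvPolynomial.induction_on' with
  | monomial a c =>
    have h1 : (monomial a c).IsHomogeneous a.degree := isHomogeneous_monomial c rfl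
    rw [compZ_of_isHomogeneous (h.mul h1), compZ_of_isHomogeneous h1]
    push_cast
    split_ifs <;> first | rfl | omega | simp
  | add q q' hq hq' => rw [mul_add, map_add, hq, hq', map_add, mul_add]

theorem compZ_finite (p : MvPolynomial σ k) : {i | compZ k i p ≠ 0}.Finite := by
  refine (p.support.finite_toSet.image fun a => (a.degree : ℤ)).subset ?_
  intro i hi
  obtain ⟨a, ha⟩ := (ne_zero_iff).1 hi
  rw [coeff_compZ] at ha
  split_ifs at ha with h
  · exact ⟨a, by simpa using ha, h⟩
  · exact absurd rfl ha

theorem compZ_sep (p : MvPolynomial σ k) (h : ∀ i, compZ k i p = 0) : p = 0 := by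
  ext a
  have := congrArg (coeff a) (h a.degree)
  simpa [coeff_compZ] using this

theorem constantCoeff_compZ (j : ℤ) (p : MvPolynomial σ k) :
    constantCoeff (compZ k j p) = if j = 0 then constantCoeff p else 0 := by
  rw [constantCoeff_eq, coeff_compZ]
  simp [eq_comm]

/-- A grading of a module over a polynomial ring, given by the projections onto the graded
pieces. -/
structure Gr (k : Type) [Field k] (σ M : Type) [AddCommGroup M] [Module (MvPolynomial σ k) M] where
  c : ℤ → M →+ M
  orth : ∀ i j m, c i (c j m) = if i = j then c j m else 0
  fin : ∀ m, {i | c i m ≠ 0}.Finite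
  sep : ∀ m, (∀ i, c i m = 0) → m = 0
  smul : ∀ (p : MvPolynomial σ k) (n : ℕ), p.IsHomogeneous n → ∀ i m, c (i + n) (p • m) = p • c i m

namespace Gr
variable {M : Type} [AddCommGroup M] [Module (MvPolynomial σ k) M] (G : Gr k σ M)

/-- The graded piece of degree `t`. -/
def gr (t : ℤ) : AddSubgroup M where
  carrier := {m | G.c t m = m}
  add_mem' {a b} ha hb := by
    simp only [Set.mem_ofPred_eq, map_add] at *
    rw [ha, hb]
  zero_mem' := by simp
  neg_mem' {a} ha := by
    simp only [Set.mem_ofPred_eq, map_neg] at *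
    rw [ha]

theorem mem_gr {t : ℤ} {m : M} : m ∈ G.gr t ↔ G.c t m = m := Iff.rfl

theorem idem (i : ℤ) (m : M) : G.c i (G.c i m) = G.c i m := by rw [G.orth, if_pos rfl]

theorem c_mem_gr (i : ℤ) (m : M) : G.c i m ∈ G.gr i := G.idem i m

theorem eq_sum (m : M) : m = ∑ i ∈ (G.fin m).toFinset, G.c i m := by
  rw [← sub_eq_zero]
  refine G.sep _ fun i => ?_
  rw [map_sub, map_sum]
  simp only [G.orth]
  rw [Finset.sum_ite_eq]
  split_ifs with h
  · exact sub_self _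
  · simpa using h

theorem c_smul {i : ℤ} {m : M} (hm : m ∈ G.gr i) (p : MvPolynomial σ k) (j : ℤ) :
    G.c j (p • m) = compZ k (j - i) p • m := by
  induction p using MvPolynomial.induction_on' with
  | monomial a c =>
    have h1 : (monomial a c).IsHomogeneous a.degree := isHomogeneous_monomial c rfl
    rw [compZ_of_isHomogeneous h1]
    have h2 := G.smul _ _ h1 (j - a.degree) m
    rw [sub_add_cancel] at h2
    rw [h2, ← G.mem_gr.1 hm, G.orth]
    split_ifs with h3 h4 h4
    · rfl
    · omega
    · omega
    · simp
  | add q q' hq hq' => rw [add_smul, map_add, hq, hq', map_add, add_smul]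

/-- The grading of a quotient by a graded submodule. -/
def quot (N : Submodule (MvPolynomial σ k) M) (hN : ∀ i, ∀ m ∈ N, G.c i m ∈ N) :
    Gr k σ (M ⧸ N) where
  c i := QuotientAddGroup.map N.toAddSubgroup N.toAddSubgroup (G.c i) (fun m hm => hN i m hm)
  orth i j m := by
    obtain ⟨m, rfl⟩ := Submodule.Quotient.mk_surjective N m
    change Submodule.Quotient.mk (G.c i (G.c j m)) = ite _ (Submodule.Quotient.mk (G.c j m)) _
    rw [G.orth]
    split_ifs <;> rfl
  fin m := by
    obtain ⟨m, rfl⟩ := Submodule.Quotient.mk_surjective N m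
    refine (G.fin m).subset fun i hi h => hi ?_
    change Submodule.Quotient.mk (G.c i m) = 0
    rw [h]
    rfl
  sep m h := by
    obtain ⟨m, rfl⟩ := Submodule.Quotient.mk_surjective N m
    rw [Submodule.Quotient.mk_eq_zero, G.eq_sum m]
    exact sum_mem fun i _ => (Submodule.Quotient.mk_eq_zero N).1 (h i)
  smul p n hp i m := by
    obtain ⟨m, rfl⟩ := Submodule.Quotient.mk_surjective N m
    change Submodule.Quotient.mk (G.c (i + n) (p • m)) = p • Submodule.Quotient.mk (G.c i m)
    rw [G.smul p n hp, Submodule.Quotient.mk_smul]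

/-- The grading of a graded submodule. -/
def sub (N : Submodule (MvPolynomial σ k) M) (hN : ∀ i, ∀ m ∈ N, G.c i m ∈ N) : Gr k σ N where
  c i := ((G.c i).comp N.subtype.toAddMonoidHom).codRestrict N.toAddSubgroup
    (fun m => hN i m m.2)
  orth i j m := by
    ext
    change G.c i (G.c j m) = _
    rw [G.orth]
    split_ifs <;> rfl
  fin m := by
    refine (G.fin m).subset fun i hi h => hi ?_
    ext
    exact h
  sep m h := by
    ext
    exact G.sep _ fun i => congrArg Subtype.val (h i)
  smul p n hp i m := by
    ext
    exact G.smul p n hp i m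

end Gr

/-- The standard grading of a free module with twists. -/
def freeGr (k : Type) [Field k] (σ : Type) {m : ℕ} (tw : Fin m → ℤ) :
    Gr k σ (Fin m → MvPolynomial σ k) where
  c i :=
    { toFun := fun f l => compZ k (i - tw l) (f l)
      map_zero' := by ext1 l; simp
      map_add' := fun f g => by ext1 l; simp }
  orth i j f := by
    ext1 l
    simp only [AddMonoidHom.coe_mk, ZeroHom.coe_mk, compZ_compZ, sub_left_inj]
    split_ifs <;> rfl
  fin f := by
    refine (Set.finite_iUnion fun l => (compZ_finite (f l)).image (· + tw l)).subset ?_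
    intro i hi
    obtain ⟨l, hl⟩ := Function.ne_iff.1 hi
    exact Set.mem_iUnion.2 ⟨l, i - tw l, hl, by simp⟩
  sep f h := by
    ext1 l
    refine compZ_sep _ fun i => ?_
    have := congrFun (h (i + tw l)) l
    simpa using this
  smul p n hp i f := by
    ext1 l
    simp only [AddMonoidHom.coe_mk, ZeroHom.coe_mk, Pi.smul_apply, smul_eq_mul]
    rw [← compZ_mul hp, sub_add_eq_add_sub]

theorem freeGr_c {m : ℕ} (tw : Fin m → ℤ) (i : ℤ) (f : Fin m → MvPolynomial σ k) (l : Fin m) :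
    (freeGr k σ tw).c i f l = compZ k (i - tw l) (f l) := rfl

/-- The standard grading of a polynomial ring. -/
def polyGr (k : Type) [Field k] (σ : Type) : Gr k σ (MvPolynomial σ k) where
  c i := (compZ k i).toAddMonoidHom
  orth := compZ_compZ
  fin := compZ_finite
  sep := compZ_sep
  smul _ _ hp i q := compZ_mul hp i q

theorem map_eq_sum_smul {P M : Type} [CommRing P] [AddCommGroup M] [Module P M] {m : ℕ}
    (φ : (Fin m → P) →ₗ[P] M) (f : Fin m → P) : φ f = ∑ l, f l • φ (Pi.single l 1) := by
  conv_lhs => rw [pi_eq_sum_univ' f]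
  simp only [map_sum, map_smul]

theorem map_c_of_basis {M : Type} [AddCommGroup M] [Module (MvPolynomial σ k) M] (G : Gr k σ M)
    {m : ℕ} (tw : Fin m → ℤ) (φ : (Fin m → MvPolynomial σ k) →ₗ[MvPolynomial σ k] M)
    (h : ∀ l, φ (Pi.single l 1) ∈ G.gr (tw l)) (i : ℤ) (f : Fin m → MvPolynomial σ k) :
    φ ((freeGr k σ tw).c i f) = G.c i (φ f) := by
  rw [map_eq_sum_smul, map_eq_sum_smul φ f, map_sum]
  exact Finset.sum_congr rfl fun l _ => (G.c_smul (h l) _ _).symm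

end Graded

section ExAt
variable {k : Type} [Field k] {σ : Type} {M : Type} [AddCommGroup M] [Module (MvPolynomial σ k) M]

/-- The part of bidegree `(i, d)` of a Koszul chain. -/
def Koszul.bi (K : Koszul k σ) (G : Gr k σ M) (i d : ℤ) : (K.T → M) →+ (K.T → M) where
  toFun f t := if K.deg t = i then G.c d (f t) else 0
  map_zero' := by ext1 t; simp
  map_add' f g := by
    ext1 t
    by_cases h : K.deg t = i <;> simp [h]

theorem Koszul.bi_apply (K : Koszul k σ) (G : Gr k σ M) (i d : ℤ) (f : K.T → M) (t : K.T) :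
    K.bi G i d f t = if K.deg t = i then G.c d (f t) else 0 := rfl

theorem Koszul.D_bi (K : Koszul k σ) (G : Gr k σ M) (i d : ℤ) (f : K.T → M) :
    K.D M (K.bi G (i + 1) (d - 1) f) = K.bi G i d (K.D M f) := by
  ext1 t
  simp only [K.D_apply, K.bi_apply, map_sum]
  by_cases h : K.deg t = i
  · rw [if_pos h]
    refine Finset.sum_congr rfl fun t' _ => ?_
    by_cases h0 : K.m t t' = 0
    · simp [h0]
    · have h1 := G.smul _ _ (K.homog t t') (d - 1) (f t')
      rw [Nat.cast_one, sub_add_cancel] at h1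
      rw [if_pos (by rw [K.deg_m _ _ h0, h]), ← h1]
  · rw [if_neg h]
    refine Finset.sum_eq_zero fun t' _ => ?_
    by_cases h0 : K.m t t' = 0
    · simp [h0]
    · rw [if_neg (by rw [K.deg_m _ _ h0]; omega), smul_zero]

/-- Chains of bidegree `(i, d)`. -/
def Koszul.IsBi (K : Koszul k σ) (G : Gr k σ M) (i d : ℤ) (z : K.T → M) : Prop :=
  K.bi G i d z = z

theorem Koszul.isBi_bi (K : Koszul k σ) (G : Gr k σ M) (i d : ℤ) (f : K.T → M) :
    K.IsBi G i d (K.bi G i d f) := by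
  ext1 t
  simp only [K.bi_apply]
  split_ifs
  · exact G.idem _ _
  · rfl

/-- Koszul homology vanishes in bidegree `(i, d)`. -/
def ExAt (K : Koszul k σ) (G : Gr k σ M) (i d : ℤ) : Prop :=
  ∀ z, K.IsBi G i d z → K.D M z = 0 → ∃ y, K.D M y = z

/-- Koszul homology vanishes above the line of slope `a`. -/
def RB (K : Koszul k σ) (G : Gr k σ M) (a : ℤ) : Prop :=
  ∀ i d, a < d → ExAt K G i d

theorem ExAt.exists_isBi {K : Koszul k σ} {G : Gr k σ M} {i d : ℤ} {z : K.T → M}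
    (hz : K.IsBi G i d z) (h : ∃ y, K.D M y = z) :
    ∃ y, K.IsBi G (i + 1) (d - 1) y ∧ K.D M y = z := by
  obtain ⟨y, hy⟩ := h
  exact ⟨_, K.isBi_bi G _ _ y, by rw [K.D_bi, hy, hz]⟩

theorem Koszul.eq_sum_bi (K : Koszul k σ) (G : Gr k σ M) (d : ℤ) (z : K.T → M)
    (hz : ∀ t, G.c d (z t) = z t) : z = ∑ i ∈ Finset.univ.image K.deg, K.bi G i d z := by
  ext1 t
  rw [Finset.sum_apply, Finset.sum_eq_single (K.deg t)]
  · rw [K.bi_apply, if_pos rfl, hz]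
  · intro i _ hi
    rw [K.bi_apply, if_neg (Ne.symm hi)]
  · simp

/-- Vanishing of Koszul homology in a fixed coefficient degree, without reference to
homological degrees. -/
theorem forall_exAt_iff (K : Koszul k σ) (G : Gr k σ M) (d : ℤ) :
    (∀ i, ExAt K G i d) ↔
      ∀ z, (∀ t, G.c d (z t) = z t) → K.D M z = 0 → ∃ y, K.D M y = z := by
  constructor
  · intro h z hz hD
    have h1 : ∀ i, ∃ y, K.D M y = K.bi G i d z := by
      intro i
      refine h i _ (K.isBi_bi G i d z) ?_
      have := K.D_bi G (i - 1) (d + 1) z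
      rw [sub_add_cancel, add_sub_cancel_right, hD, map_zero] at this
      exact this
    choose y hy using h1
    refine ⟨∑ i ∈ Finset.univ.image K.deg, y i, ?_⟩
    rw [map_sum]
    simp only [hy]
    exact (K.eq_sum_bi G d z hz).symm
  · intro h i z hz hD
    refine h z (fun t => ?_) hD
    have := congrFun hz t
    rw [← this, K.bi_apply]
    split_ifs
    · exact G.idem _ _
    · exact map_zero _

section Sequence
variable {Z F : Type} [AddCommGroup Z] [Module (MvPolynomial σ k) Z] [AddCommGroup F]
  [Module (MvPolynomial σ k) F]

theorem Koszul.bi_map (K : Koszul k σ) {G : Gr k σ M} {GF : Gr k σ F}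
    (φ : F →ₗ[MvPolynomial σ k] M) (hφ : ∀ i f, φ (GF.c i f) = G.c i (φ f)) (i d : ℤ)
    (f : K.T → F) : K.bi G i d (fun t => φ (f t)) = fun t => φ (K.bi GF i d f t) := by
  ext1 t
  simp only [K.bi_apply]
  split_ifs
  · rw [hφ]
  · simp

theorem exAt_left (K : Koszul k σ) {G : Gr k σ M} {GF : Gr k σ F} {GZ : Gr k σ Z}
    (ι : Z →ₗ[MvPolynomial σ k] F) (φ : F →ₗ[MvPolynomial σ k] M)
    (hι : ∀ i f, ι (GZ.c i f) = GF.c i (ι f)) (hφ : ∀ i f, φ (GF.c i f) = G.c i (φ f))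
    (hinj : Function.Injective ι) (hsurj : Function.Surjective φ)
    (hex : LinearMap.range ι = LinearMap.ker φ) {i d : ℤ}
    (hF : ∀ z, K.D Z z = 0 → ∃ y, K.D F y = fun t => ι (z t))
    (hM : ExAt K G (i + 1) (d - 1)) : ExAt K GZ i d := by
  intro z hz hDz
  have hz' : K.IsBi GF i d (fun t => ι (z t)) := by
    rw [Koszul.IsBi, K.bi_map ι hι]
    ext1 t
    rw [hz]
  obtain ⟨y, hy, hDy⟩ := ExAt.exists_isBi hz' (hF z hDz)
  have hφι : ∀ x, φ (ι x) = 0 := fun x =>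
    LinearMap.mem_ker.1 (hex ▸ LinearMap.mem_range_self ι x)
  obtain ⟨w, hw⟩ := hM (fun t => φ (y t)) (by
    rw [Koszul.IsBi, K.bi_map φ hφ]
    ext1 t
    rw [hy]) (by
    rw [K.D_comp, hDy]
    ext1 t
    exact hφι _)
  choose v hv using fun t => hsurj (w t)
  have h1 : ∀ t, ∃ u, ι u = y t - K.D F v t := by
    intro t
    have : y t - K.D F v t ∈ LinearMap.range ι := by
      rw [hex, LinearMap.mem_ker, map_sub, sub_eq_zero, ← congrFun (K.D_comp φ v) t]
      simp only [hv]
      exact (congrFun hw t).symm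
    exact this
  choose u hu using h1
  refine ⟨u, ?_⟩
  ext1 t
  apply hinj
  rw [← congrFun (K.D_comp ι u) t]
  have h2 : (fun t => ι (u t)) = y - K.D F v := by
    ext1 t
    exact hu t
  rw [h2, map_sub, K.D_D, sub_zero, hDy]

theorem exAt_right (K : Koszul k σ) {G : Gr k σ M} {GF : Gr k σ F} {GZ : Gr k σ Z}
    (ι : Z →ₗ[MvPolynomial σ k] F) (φ : F →ₗ[MvPolynomial σ k] M)
    (hι : ∀ i f, ι (GZ.c i f) = GF.c i (ι f)) (hφ : ∀ i f, φ (GF.c i f) = G.c i (φ f))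
    (hinj : Function.Injective ι) (hsurj : Function.Surjective φ)
    (hex : LinearMap.range ι = LinearMap.ker φ) {i d : ℤ}
    (hF : ExAt K GF i d) (hZ : ExAt K GZ (i - 1) (d + 1)) : ExAt K G i d := by
  intro z hz hDz
  choose v hv using fun t => hsurj (z t)
  have hφι : ∀ x, φ (ι x) = 0 := fun x =>
    LinearMap.mem_ker.1 (hex ▸ LinearMap.mem_range_self ι x)
  set v' := K.bi GF i d v with hv'
  have h1 : (fun t => φ (v' t)) = z := by
    rw [← K.bi_map φ hφ]
    simp only [hv]
    exact hz
  have h2 : ∀ t, ∃ u, ι u = K.D F v' t := by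
    intro t
    have : K.D F v' t ∈ LinearMap.range ι := by
      rw [hex, LinearMap.mem_ker, ← congrFun (K.D_comp φ v') t, h1, hDz]
      rfl
    exact this
  choose u hu using h2
  have hu' : (fun t => ι (u t)) = K.D F v' := funext hu
  have h3 : K.IsBi GZ (i - 1) (d + 1) u := by
    ext1 t
    apply hinj
    rw [← congrFun (K.bi_map ι hι (i - 1) (d + 1) u) t, hu', ← K.D_bi, sub_add_cancel,
      add_sub_cancel_right, hv', K.isBi_bi, hu]
  have h4 : K.D Z u = 0 := by
    ext1 t
    apply hinj
    rw [← congrFun (K.D_comp ι u) t, hu', K.D_D]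
    simp
  obtain ⟨x, hx⟩ := hZ u h3 h4
  obtain ⟨y, hy⟩ := hF (K.bi GF i d (v' - fun t => ι (x t))) (K.isBi_bi _ _ _ _) (by
    have := K.D_bi GF (i - 1) (d + 1) (v' - fun t => ι (x t))
    have h5 : K.D F (v' - fun t => ι (x t)) = 0 := by
      rw [map_sub, K.D_comp, hx, hu', sub_self]
    rw [sub_add_cancel, add_sub_cancel_right, h5, map_zero] at this
    exact this)
  refine ⟨fun t => φ (y t), ?_⟩
  rw [K.D_comp, hy, ← K.bi_map φ hφ]
  have h5 : (fun t => φ ((v' - fun t => ι (x t)) t)) = z := by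
    rw [← h1]
    ext1 t
    simp [hφι]
  rw [h5]
  exact hz

end Sequence

theorem exists_D_eq_of_free (K : Koszul k σ) {m : ℕ} (z : K.T → Fin m → MvPolynomial σ k)
    (hz : K.D _ z = 0) (h0 : ∀ l, constantCoeff (z K.t0 l) = 0) : ∃ y, K.D _ y = z := by
  have h1 : ∀ l, ∃ y, K.D (MvPolynomial σ k) y = fun t => z t l := by
    intro l
    refine K.acyc _ ?_ (h0 l)
    have := K.D_comp (LinearMap.proj l : (Fin m → MvPolynomial σ k) →ₗ[MvPolynomial σ k] _) z
    rw [hz] at this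
    exact this
  choose y hy using h1
  refine ⟨fun t l => y l t, ?_⟩
  ext1 t
  ext1 l
  have := K.D_comp (LinearMap.proj l : (Fin m → MvPolynomial σ k) →ₗ[MvPolynomial σ k] _)
    (fun t l => y l t)
  have h2 := congrFun this t
  simp only [LinearMap.proj_apply] at h2
  rw [← h2, hy]

theorem exAt_freeGr (K : Koszul k σ) {m : ℕ} (tw : Fin m → ℤ) {i d : ℤ} (h : ∀ l, tw l ≠ d) :
    ExAt K (freeGr k σ tw) i d := by
  intro z hz hD
  refine exists_D_eq_of_free K z hD fun l => ?_
  have := congrFun (congrFun hz K.t0) l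
  rw [← this, K.bi_apply]
  split_ifs
  · rw [freeGr_c, constantCoeff_compZ, if_neg]
    have := h l
    omega
  · simp

theorem rb_of_gradedFreeRes (K : Koszul k σ) (G : Gr k σ M) (R : GradedFreeRes k σ M G.gr)
    (a : ℤ) (ha : ∀ i l, R.tw i l - (i : ℤ) ≤ a) : RB K G a := by
  have hd : ∀ n i f, R.d n ((freeGr k σ (R.tw (n + 1))).c i f) =
      (freeGr k σ (R.tw n)).c i (R.d n f) := fun n =>
    map_c_of_basis _ _ _ fun l => by
      rw [Gr.mem_gr]
      ext1 l'
      rw [freeGr_c]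
      exact (homogZ_iff _ _).1 (R.d_homog n l l')
  have haug := map_c_of_basis G _ R.aug R.aug_homog
  have hr : ∀ n i, ∀ f ∈ LinearMap.range (R.d n), (freeGr k σ (R.tw n)).c i f ∈
      LinearMap.range (R.d n) := by
    rintro n i _ ⟨f, rfl⟩
    exact ⟨_, hd n i f⟩
  obtain ⟨N, hN⟩ := R.bdd
  have key : ∀ j n, N ≤ n + j → RB K ((freeGr k σ (R.tw n)).sub _ (hr n)) (a + n + 1) := by
    intro j
    induction j with
    | zero =>
      intro n hn i d _ z _ _
      refine ⟨0, ?_⟩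
      ext1 t
      obtain ⟨f, hf⟩ := (z t).2
      have : IsEmpty (Fin (R.rk (n + 1))) := by rw [hN (n + 1) (by omega)]; infer_instance
      ext1
      rw [← hf, Subsingleton.elim f 0]
      simp
    | succ j ih =>
      intro n hn i d hd'
      refine exAt_right K (G := (freeGr k σ (R.tw n)).sub _ (hr n))
        (GF := freeGr k σ (R.tw (n + 1)))
        (GZ := (freeGr k σ (R.tw (n + 1))).sub _ (hr (n + 1)))
        (LinearMap.range (R.d (n + 1))).subtype (R.d n).rangeRestrict (fun _ _ => rfl)
        (fun i f => Subtype.ext (hd n i f)) Subtype.coe_injective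
        (LinearMap.surjective_rangeRestrict _) ?_ ?_ ?_
      · rw [Submodule.range_subtype, LinearMap.ker_rangeRestrict, R.exact_succ]
      · refine exAt_freeGr K _ fun l => ?_
        have := ha (n + 1) l
        push_cast at this
        omega
      · refine ih (n + 1) (by omega) _ _ ?_
        push_cast
        omega
  intro i d hd'
  refine exAt_right K (GF := freeGr k σ (R.tw 0)) (GZ := (freeGr k σ (R.tw 0)).sub _ (hr 0))
        (LinearMap.range (R.d 0)).subtype R.aug (fun _ _ => rfl)
        haug Subtype.coe_injective R.aug_surj ?_ ?_ ?_
  · rw [Submodule.range_subtype, R.exact_zero]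
  · refine exAt_freeGr K _ fun l => ?_
    have := ha 0 l
    push_cast at this
    omega
  · refine key N 0 (by omega) _ _ ?_
    push_cast
    omega

end ExAt

section Resolution
variable {k : Type} [Field k] {σ : Type} {M : Type} [AddCommGroup M] [Module (MvPolynomial σ k) M]

/-- A homogeneous generating family of `N` elements. -/
def HasCover (G : Gr k σ M) (N : ℕ) : Prop :=
  ∃ (tw : Fin N → ℤ) (φ : (Fin N → MvPolynomial σ k) →ₗ[MvPolynomial σ k] M),
    Function.Surjective φ ∧ ∀ l, φ (Pi.single l 1) ∈ G.gr (tw l)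

theorem exists_hasCover [Module.Finite (MvPolynomial σ k) M] (G : Gr k σ M) :
    ∃ N, HasCover G N := by
  classical
  obtain ⟨S, hS⟩ := Module.Finite.fg_top (R := MvPolynomial σ k) (M := M)
  let T : Finset M := S.biUnion fun m => (G.fin m).toFinset.image fun i => G.c i m
  have hT : ∀ x : T, ∃ i, (x : M) ∈ G.gr i := by
    rintro ⟨x, hx⟩
    simp only [T, Finset.mem_biUnion, Finset.mem_image] at hx
    obtain ⟨m, _, i, _, rfl⟩ := hx
    exact ⟨i, G.c_mem_gr i m⟩
  choose tw htw using hT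
  let e := Fintype.equivFin T
  refine ⟨Fintype.card T, fun l => tw (e.symm l),
    Fintype.linearCombination _ fun l => (e.symm l : M), ?_, fun l => ?_⟩
  · rw [← LinearMap.range_eq_top, Fintype.range_linearCombination, eq_top_iff, ← hS,
      Submodule.span_le]
    intro m hm
    rw [G.eq_sum m]
    refine sum_mem fun i hi => Submodule.subset_span ?_
    have h1 : G.c i m ∈ T := by
      simp only [T, Finset.mem_biUnion, Finset.mem_image]
      exact ⟨m, hm, i, hi, rfl⟩
    exact ⟨e ⟨_, h1⟩, by simp⟩
  · rw [Fintype.linearCombination_apply_single, one_smul]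
    exact htw _

theorem HasCover.of_constantCoeff_ne {G : Gr k σ M} {N : ℕ} {tw : Fin (N + 1) → ℤ}
    {φ : (Fin (N + 1) → MvPolynomial σ k) →ₗ[MvPolynomial σ k] M} (hs : Function.Surjective φ)
    (hφ : ∀ l, φ (Pi.single l 1) ∈ G.gr (tw l)) {f : Fin (N + 1) → MvPolynomial σ k}
    (hf : φ f = 0) {l : Fin (N + 1)} (hl : constantCoeff (f l) ≠ 0) : HasCover G N := by
  let ψ := Fintype.linearCombination (MvPolynomial σ k)
    fun j : Fin N => φ (Pi.single (l.succAbove j) 1)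
  have hψ : ∀ j, ψ (Pi.single j 1) = φ (Pi.single (l.succAbove j) 1) := fun j => by
    rw [Fintype.linearCombination_apply_single, one_smul]
  have h1 : ∀ j, φ (Pi.single (l.succAbove j) 1) ∈ LinearMap.range ψ := fun j => ⟨_, hψ j⟩
  have h2 : φ (Pi.single l 1) ∈ LinearMap.range ψ := by
    have h3 : φ ((freeGr k σ tw).c (tw l) f) = 0 := by
      rw [map_c_of_basis G tw φ hφ, hf, map_zero]
    rw [map_eq_sum_smul, Fin.sum_univ_succAbove _ l, freeGr_c, sub_self] at h3
    have h4 : compZ k 0 (f l) = C (constantCoeff (f l)) := by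
      rw [compZ, if_pos le_rfl, Int.toNat_zero, homogeneousComponent_zero, constantCoeff_eq]
    rw [h4, add_eq_zero_iff_eq_neg] at h3
    have h5 : φ (Pi.single l 1) = (C (constantCoeff (f l))⁻¹ : MvPolynomial σ k) •
        ((C (constantCoeff (f l)) : MvPolynomial σ k) • φ (Pi.single l 1)) := by
      rw [smul_smul, ← C_mul, inv_mul_cancel₀ hl, C_1, one_smul]
    rw [h5, h3]
    exact Submodule.smul_mem _ _ (neg_mem (sum_mem fun j _ => Submodule.smul_mem _ _ (h1 j)))
  refine ⟨fun j => tw (l.succAbove j), ψ, ?_, fun j => hψ j ▸ hφ _⟩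
  rw [← LinearMap.range_eq_top, eq_top_iff]
  rintro m -
  obtain ⟨g, rfl⟩ := hs m
  rw [map_eq_sum_smul, Fin.sum_univ_succAbove _ l]
  exact add_mem (Submodule.smul_mem _ _ h2) (sum_mem fun j _ => Submodule.smul_mem _ _ (h1 j))

theorem exists_minimal_cover [Module.Finite (MvPolynomial σ k) M] (G : Gr k σ M) :
    ∃ (N : ℕ) (tw : Fin N → ℤ) (φ : (Fin N → MvPolynomial σ k) →ₗ[MvPolynomial σ k] M),
      Function.Surjective φ ∧ (∀ l, φ (Pi.single l 1) ∈ G.gr (tw l)) ∧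
        ∀ f, φ f = 0 → ∀ l, constantCoeff (f l) = 0 := by
  classical
  have h := exists_hasCover G
  obtain ⟨tw, φ, hs, hφ⟩ := Nat.find_spec h
  refine ⟨Nat.find h, tw, φ, hs, hφ, fun f hf l => ?_⟩
  by_contra hl
  obtain ⟨N, hN⟩ : ∃ N, Nat.find h = N + 1 :=
    Nat.exists_eq_succ_of_ne_zero fun h0 => by
      have := l.2
      omega
  have key : ∀ m, Nat.find h = m + 1 → HasCover G m := by
    intro m hm
    generalize Nat.find h = m' at *
    subst hm
    exact HasCover.of_constantCoeff_ne hs hφ hf hl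
  exact Nat.find_min h (by omega) (key N hN)

/-- A graded free resolution of a kernel extends to one of the cokernel. -/
def GradedFreeRes.cons {N : ℕ} (G : Gr k σ M) (tw : Fin N → ℤ)
    (φ : (Fin N → MvPolynomial σ k) →ₗ[MvPolynomial σ k] M) (hs : Function.Surjective φ)
    (hφ : ∀ l, φ (Pi.single l 1) ∈ G.gr (tw l))
    (hk : ∀ i, ∀ f ∈ LinearMap.ker φ, (freeGr k σ tw).c i f ∈ LinearMap.ker φ)
    (F : GradedFreeRes k σ (LinearMap.ker φ) ((freeGr k σ tw).sub (LinearMap.ker φ) hk).gr) :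
    GradedFreeRes k σ M G.gr where
  rk n := match n with
    | 0 => N
    | n + 1 => F.rk n
  tw n := match n with
    | 0 => tw
    | n + 1 => F.tw n
  bdd := by
    obtain ⟨B, hB⟩ := F.bdd
    refine ⟨B + 1, fun i hi => ?_⟩
    obtain ⟨j, rfl⟩ : ∃ j, i = j + 1 := ⟨i - 1, by omega⟩
    exact hB j (by omega)
  aug := φ
  d n := match n with
    | 0 => (LinearMap.ker φ).subtype ∘ₗ F.aug
    | n + 1 => F.d n
  aug_surj := hs
  exact_zero := by
    rw [LinearMap.range_comp, LinearMap.range_eq_top.2 F.aug_surj, Submodule.map_top,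
      Submodule.range_subtype]
  exact_succ n := match n with
    | 0 => by
      rw [LinearMap.ker_comp, Submodule.ker_subtype]
      exact F.exact_zero
    | n + 1 => F.exact_succ n
  aug_homog := hφ
  d_homog n := match n with
    | 0 => fun l l' => by
      rw [homogZ_iff]
      exact congrFun (congrArg Subtype.val (F.aug_homog l)) l'
    | n + 1 => F.d_homog n

theorem constantCoeff_of_isHomogeneous_one {p : MvPolynomial σ k} (h : p.IsHomogeneous 1) :
    constantCoeff p = 0 := by
  rw [constantCoeff_eq]
  exact h.coeff_eq_zero (by simp)

/-- The degree of a minimal generator supports nonzero Koszul homology. -/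
theorem not_exAt_of_minimal (K : Koszul k σ) (G : Gr k σ M) {N : ℕ} (tw : Fin N → ℤ)
    (φ : (Fin N → MvPolynomial σ k) →ₗ[MvPolynomial σ k] M) (hs : Function.Surjective φ)
    (hφ : ∀ l, φ (Pi.single l 1) ∈ G.gr (tw l))
    (hm : ∀ f, φ f = 0 → ∀ l, constantCoeff (f l) = 0) (l : Fin N) : ¬ ExAt K G 0 (tw l) := by
  classical
  intro h
  obtain ⟨y, hy⟩ := h (Pi.single K.t0 (φ (Pi.single l 1))) (by
    ext1 t
    by_cases ht : t = K.t0
    · subst ht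
      rw [K.bi_apply, if_pos K.deg_t0, Pi.single_eq_same]
      exact hφ l
    · rw [K.bi_apply, Pi.single_eq_of_ne ht]
      simp) (by
    ext1 t
    rw [K.D_apply]
    refine Finset.sum_eq_zero fun t' _ => ?_
    by_cases ht : t' = K.t0
    · subst ht
      by_cases h0 : K.m t K.t0 = 0
      · simp [h0]
      · have h1 := K.deg_m _ _ h0
        have h2 := K.deg_nonneg t
        rw [K.deg_t0] at h1
        omega
    · rw [Pi.single_eq_of_ne ht, smul_zero])
  choose v hv using fun t => hs (y t)
  have h1 := congrFun hy K.t0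
  rw [Pi.single_eq_same, K.D_apply] at h1
  have h2 := hm (Pi.single l 1 - ∑ t, K.m K.t0 t • v t) (by
    rw [map_sub, map_sum, ← h1, sub_eq_zero]
    exact Finset.sum_congr rfl fun t _ => by rw [map_smul, hv]) l
  simp only [Pi.sub_apply, Pi.single_eq_same, map_sub, Finset.sum_apply, Pi.smul_apply,
    smul_eq_mul, map_sum, map_mul, constantCoeff_of_isHomogeneous_one (K.homog _ _), zero_mul,
    Finset.sum_const_zero, sub_zero, map_one] at h2
  exact one_ne_zero h2

theorem exists_gradedFreeRes_of_exAt [Finite σ] (K : Koszul k σ) (i : ℕ) :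
    ∀ (M : Type) [AddCommGroup M] [Module (MvPolynomial σ k) M]
      [Module.Finite (MvPolynomial σ k) M] (G : Gr k σ M),
      (∀ j : ℤ, (i : ℤ) ≤ j → ∀ d, ExAt K G j d) →
      ∃ F : GradedFreeRes k σ M G.gr, ∀ a, RB K G a → ∀ n l, F.tw n l - (n : ℤ) ≤ a := by
  induction i with
  | zero =>
    intro M _ _ _ G h
    obtain ⟨N, tw, φ, hs, hφ, hm⟩ := exists_minimal_cover G
    have h0 : IsEmpty (Fin N) := ⟨fun l =>
      not_exAt_of_minimal K G tw φ hs hφ hm l (h 0 (by simp) _)⟩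
    have hM : Subsingleton M := hs.subsingleton
    exact ⟨{
      rk := fun _ => 0
      tw := fun _ _ => 0
      bdd := ⟨0, fun _ _ => rfl⟩
      aug := 0
      d := fun _ => 0
      aug_surj := fun m => ⟨0, Subsingleton.elim _ _⟩
      exact_zero := Subsingleton.elim _ _
      exact_succ := fun _ => Subsingleton.elim _ _
      aug_homog := fun l => l.elim0
      d_homog := fun _ l => l.elim0 }, fun _ _ _ l => l.elim0⟩
  | succ i ih =>
    intro M _ _ _ G h
    obtain ⟨N, tw, φ, hs, hφ, hm⟩ := exists_minimal_cover G
    have hc := map_c_of_basis G tw φ hφ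
    have hk : ∀ i, ∀ f ∈ LinearMap.ker φ, (freeGr k σ tw).c i f ∈ LinearMap.ker φ := by
      intro i f hf
      rw [LinearMap.mem_ker] at *
      rw [hc, hf, map_zero]
    have hZ : ∀ j d, ExAt K G (j + 1) (d - 1) →
        ExAt K ((freeGr k σ tw).sub (LinearMap.ker φ) hk) j d := by
      intro j d hjd
      refine exAt_left K (GF := freeGr k σ tw) (LinearMap.ker φ).subtype φ (fun _ _ => rfl) hc
        Subtype.coe_injective hs (Submodule.range_subtype _) (fun z hz => ?_) hjd
      refine exists_D_eq_of_free K _ ?_ fun l => hm _ (z K.t0).2 l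
      rw [K.D_comp, hz]
      ext1 t
      simp
    obtain ⟨F, hF⟩ := ih (LinearMap.ker φ) ((freeGr k σ tw).sub (LinearMap.ker φ) hk)
      (fun j hj d => hZ j d (h _ (by push_cast; omega) _))
    refine ⟨F.cons G tw φ hs hφ hk, fun a ha n => ?_⟩
    match n with
    | 0 =>
      intro l
      by_contra hl
      refine not_exAt_of_minimal K G tw φ hs hφ hm l (ha _ _ ?_)
      change ¬ (tw l - ((0 : ℕ) : ℤ) ≤ a) at hl
      push_cast at hl
      omega
    | n + 1 =>
      intro l
      have := hF (a + 1) (fun j d hd => hZ j d (ha _ _ (by omega))) n l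
      change F.tw n l - ((n + 1 : ℕ) : ℤ) ≤ a
      push_cast
      omega

/-- Regularity is detected by Koszul homology. -/
theorem regM_le_iff [Finite σ] [Module.Finite (MvPolynomial σ k) M] [Nontrivial M]
    (K : Koszul k σ) (G : Gr k σ M) (hneg : ∀ i < 0, ∀ m, G.c i m = 0) (a : ℤ) :
    regM k σ M G.gr ≤ a ↔ RB K G a := by
  obtain ⟨i, hi⟩ : ∃ i : ℕ, ∀ t, K.deg t < i := by
    obtain ⟨b, hb⟩ := (Set.finite_range K.deg).bddAbove
    refine ⟨(b + 1).toNat, fun t => ?_⟩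
    have := hb ⟨t, rfl⟩
    omega
  obtain ⟨F, hF⟩ := exists_gradedFreeRes_of_exAt K i M G (by
    intro j hj d z hz _
    refine ⟨0, ?_⟩
    rw [← hz]
    ext1 t
    rw [K.bi_apply, if_neg (by have := hi t; omega)]
    simp)
  set S := {r : ℤ | ∃ F : GradedFreeRes k σ M G.gr, ∀ i (l : Fin (F.rk i)),
    F.tw i l - (i : ℤ) ≤ r} with hS
  have hne : S.Nonempty := by
    obtain ⟨N, hN⟩ := F.bdd
    obtain ⟨b, hb⟩ := (Set.finite_iUnion fun n : Fin N =>
      Set.finite_range fun l => F.tw n l - ((n : ℕ) : ℤ)).bddAbove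
    refine ⟨b, F, fun n l => ?_⟩
    by_cases hn : n < N
    · exact hb (Set.mem_iUnion.2 ⟨⟨n, hn⟩, l, rfl⟩)
    · have := hN n (by omega)
      exact (Fin.cast this l).elim0
  have hbdd : BddBelow S := by
    refine ⟨0, ?_⟩
    rintro r ⟨F', hF'⟩
    by_contra hr
    obtain ⟨m, hm⟩ := exists_ne (0 : M)
    apply hm
    obtain ⟨f, rfl⟩ := F'.aug_surj m
    rw [map_eq_sum_smul]
    refine Finset.sum_eq_zero fun l _ => ?_
    have h1 := hF' 0 l
    have h2 := (G.mem_gr.1 (F'.aug_homog l)).symm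
    rw [h2, hneg _ (by push_cast at h1; omega), smul_zero]
  constructor
  · intro h
    obtain ⟨F', hF'⟩ := Int.csInf_mem hne hbdd
    exact rb_of_gradedFreeRes K G F' a fun n l => (hF' n l).trans h
  · intro h
    exact csInf_le hbdd ⟨F, hF a h⟩

end Resolution

section Relative
variable {k : Type} [Field k] {σ τ : Type}

/-- Homogeneity of an ideal in terms of integral degrees. -/
def HomogId (k : Type) [Field k] {σ : Type} (p : Ideal (MvPolynomial σ k)) : Prop :=
  ∀ i : ℤ, ∀ f ∈ p, compZ k i f ∈ p

theorem homogId_of_isHomogeneousIdeal {p : Ideal (MvPolynomial σ k)}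
    (h : IsHomogeneousIdeal k p) : HomogId k p := by
  intro i f hf
  unfold compZ
  split_ifs
  · exact h f hf _
  · exact zero_mem _

theorem homogId_top : HomogId k (⊤ : Ideal (MvPolynomial σ k)) := fun _ _ _ => trivial

theorem HomogId.sup {p q : Ideal (MvPolynomial σ k)} (hp : HomogId k p) (hq : HomogId k q) :
    HomogId k (p ⊔ q) := by
  intro i f hf
  obtain ⟨a, ha, b, hb, rfl⟩ := Submodule.mem_sup.1 hf
  rw [map_add]
  exact Submodule.add_mem_sup (hp i a ha) (hq i b hb)

theorem compZ_mul_eq_sum (i : ℤ) (f g : MvPolynomial σ k) :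
    compZ k i (f * g) =
      ∑ j ∈ ((polyGr k σ).fin g).toFinset, compZ k (i - j) f * compZ k j g := by
  have h := (polyGr k σ).eq_sum g
  conv_lhs => rw [h]
  rw [Finset.mul_sum, map_sum]
  exact Finset.sum_congr rfl fun j _ =>
    (polyGr k σ).c_smul ((polyGr k σ).c_mem_gr j g) f i

theorem HomogId.mul {p q : Ideal (MvPolynomial σ k)} (hp : HomogId k p) (hq : HomogId k q) :
    HomogId k (p * q) := by
  intro i f hf
  induction hf using Submodule.mul_induction_on' with
  | mem_mul_mem m hm n hn =>
    rw [compZ_mul_eq_sum]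
    exact sum_mem fun j _ => Ideal.mul_mem_mul (hp _ _ hm) (hq _ _ hn)
  | add x _ y _ hx hy =>
    rw [map_add]
    exact add_mem hx hy

theorem HomogId.pow {p : Ideal (MvPolynomial σ k)} (hp : HomogId k p) (n : ℕ) :
    HomogId k (p ^ n) := by
  induction n with
  | zero => rw [pow_zero, Ideal.one_eq_top]; exact homogId_top
  | succ n ih => rw [pow_succ]; exact ih.mul hp

theorem homogId_span {S : Set (MvPolynomial σ k)}
    (h : ∀ i, ∀ f ∈ S, compZ k i f ∈ Ideal.span S) : HomogId k (Ideal.span S) := by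
  intro i f hf
  induction hf using Submodule.span_induction generalizing i with
  | mem x hx => exact h i x hx
  | zero => rw [map_zero]; exact zero_mem _
  | add x y _ _ hx hy => rw [map_add]; exact add_mem (hx i) (hy i)
  | smul a x _ hx =>
    rw [smul_eq_mul, compZ_mul_eq_sum]
    exact sum_mem fun j _ => Ideal.mul_mem_left _ _ (hx j)

theorem rename_compZ (φ : σ → τ) (i : ℤ) (p : MvPolynomial σ k) :
    rename φ (compZ k i p) = compZ k i (rename φ p) := by
  unfold compZ
  split_ifs
  · exact (rename_homogeneousComponent _ _)
  · simp

theorem HomogId.map_rename {p : Ideal (MvPolynomial σ k)} (hp : HomogId k p) (φ : σ → τ) :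
    HomogId k (p.map (rename φ : MvPolynomial σ k →ₐ[k] MvPolynomial τ k)) := by
  refine homogId_span ?_
  rintro i _ ⟨f, hf, rfl⟩
  refine Ideal.subset_span ⟨_, hp i f hf, ?_⟩
  exact rename_compZ φ i f

/-- Koszul cycles modulo `q`, with entries in `p` of degree `d`, are boundaries modulo `q`. -/
def Koszul.Rel (K : Koszul k σ) (p q : Ideal (MvPolynomial σ k)) (d : ℤ) : Prop :=
  ∀ f : K.T → MvPolynomial σ k, (∀ t, f t ∈ p) → (∀ t, compZ k d (f t) = f t) →
    (∀ t, K.D _ f t ∈ q) → ∃ g : K.T → MvPolynomial σ k, (∀ t, g t ∈ p) ∧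
      ∀ t, f t - K.D _ g t ∈ q

theorem Koszul.compZ_D (K : Koszul k σ) (d : ℤ) (f : K.T → MvPolynomial σ k) (t : K.T) :
    compZ k d (K.D _ f t) = K.D _ (fun t => compZ k (d - 1) (f t)) t := by
  simp only [K.D_apply, map_sum, smul_eq_mul]
  refine Finset.sum_congr rfl fun t' _ => ?_
  rw [← compZ_mul (K.homog t t'), Nat.cast_one, sub_add_cancel]

theorem Koszul.Rel.trans {K : Koszul k σ} {p q r : Ideal (MvPolynomial σ k)} {d : ℤ}
    (hp : HomogId k p) (hq : HomogId k q) (hqp : q ≤ p) (hrq : r ≤ q)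
    (h₁ : K.Rel p q d) (h₂ : K.Rel q r d) : K.Rel p r d := by
  intro f hf hfd hD
  obtain ⟨g, hg, hfg⟩ := h₁ f hf hfd fun t => hrq (hD t)
  have key : ∀ t, compZ k d (f t - K.D _ g t) =
      f t - K.D _ (fun t => compZ k (d - 1) (g t)) t := by
    intro t
    rw [map_sub, hfd, K.compZ_D]
  obtain ⟨g', hg', hfg'⟩ := h₂ (f - K.D _ (fun t => compZ k (d - 1) (g t)))
    (fun t => by
      rw [Pi.sub_apply, ← key]
      exact hq _ _ (hfg t))
    (fun t => by
      rw [Pi.sub_apply, ← key, compZ_compZ, if_pos rfl])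
    (fun t => by
      rw [map_sub, K.D_D, sub_zero]
      exact hD t)
  refine ⟨(fun t => compZ k (d - 1) (g t)) + g', fun t => ?_, fun t => ?_⟩
  · exact add_mem (hp _ _ (hg t)) (hqp (hg' t))
  · have := hfg' t
    rw [map_add, Pi.add_apply, ← sub_sub]
    exact this

theorem rb_iff_rel {M : Type} [AddCommGroup M] [Module (MvPolynomial σ k) M] (K : Koszul k σ)
    (G : Gr k σ M) {p q : Ideal (MvPolynomial σ k)} (hp : HomogId k p)
    (φ : p →ₗ[MvPolynomial σ k] M) (hs : Function.Surjective φ)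
    (hker : ∀ x, φ x = 0 ↔ (x : MvPolynomial σ k) ∈ q)
    (hφ : ∀ i x, φ (((polyGr k σ).sub p hp).c i x) = G.c i (φ x)) (a : ℤ) :
    RB K G a ↔ ∀ d, a < d → K.Rel p q d := by
  have h0 : RB K G a ↔ ∀ d, a < d → ∀ i, ExAt K G i d :=
    ⟨fun h d hd i => h i d hd, fun h i d hd => h d hd i⟩
  rw [h0]
  refine forall_congr' fun d => imp_congr_right fun _ => ?_
  rw [forall_exAt_iff]
  have hcoe : ∀ g : K.T → p, (fun t => ((K.D p g t : p) : MvPolynomial σ k)) =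
      K.D _ (fun t => (g t : MvPolynomial σ k)) := fun g => (K.D_comp p.subtype g).symm
  constructor
  · intro h f hf hfd hD
    have h1 : K.D M (fun t => φ ⟨f t, hf t⟩) = 0 := by
      rw [K.D_comp]
      ext1 t
      rw [Pi.zero_apply, hker, congrFun (hcoe _) t]
      exact hD t
    obtain ⟨y, hy⟩ := h (fun t => φ ⟨f t, hf t⟩) (fun t => by
      rw [← hφ]
      congr 1
      ext1
      exact hfd t) h1
    choose g hg using fun t => hs (y t)
    refine ⟨fun t => g t, fun t => (g t).2, fun t => ?_⟩
    rw [← congrFun (hcoe _) t]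
    change (((⟨f t, hf t⟩ - K.D p g t : p) : p) : MvPolynomial σ k) ∈ q
    rw [← hker, map_sub, sub_eq_zero, ← congrFun (K.D_comp φ g) t]
    simp only [hg]
    exact (congrFun hy t).symm
  · intro h z hz hD
    choose f hf using fun t => hs (z t)
    let f' := fun t => ((polyGr k σ).sub p hp).c d (f t)
    have hf' : ∀ t, φ (f' t) = z t := fun t => by rw [hφ, hf, hz]
    obtain ⟨g, hg, hfg⟩ := h (fun t => f' t) (fun t => (f' t).2)
      (fun t => (polyGr k σ).idem d (f t)) (fun t => by
        rw [← congrFun (hcoe f') t, ← hker, ← congrFun (K.D_comp φ f') t]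
        simp only [hf']
        rw [hD]
        rfl)
    refine ⟨fun t => φ ⟨g t, hg t⟩, ?_⟩
    rw [K.D_comp]
    ext1 t
    rw [← hf', eq_comm, ← sub_eq_zero, ← map_sub, hker, Submodule.coe_sub, congrFun (hcoe _) t]
    exact hfg t

theorem regSubQuot_le_iff [Finite σ] (K : Koszul k σ) {p q : Ideal (MvPolynomial σ k)}
    (hp : HomogId k p) (hq : HomogId k q) (hpq : ¬ p ≤ q) (a : ℤ) :
    regSubQuot k p q ≤ a ↔ ∀ d, a < d → K.Rel p q d := by
  let N := Submodule.comap p.subtype q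
  let G : Gr k σ (subQuot k p q) := ((polyGr k σ).sub p hp).quot N fun i m hm => hq i m hm
  have hG : subQuotGr k p q = G.gr := by
    funext t
    apply le_antisymm
    · refine (AddSubgroup.closure_le _).2 ?_
      rintro _ ⟨f, hf, rfl⟩
      change Submodule.Quotient.mk _ = _
      congr 1
      ext1
      exact (homogZ_iff _ _).1 hf
    · intro x hx
      obtain ⟨f, rfl⟩ := Submodule.Quotient.mk_surjective N x
      rw [← G.mem_gr.1 hx]
      refine AddSubgroup.subset_closure ⟨⟨compZ k t f, hp t f f.2⟩, ?_, rfl⟩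
      rw [homogZ_iff, compZ_compZ, if_pos rfl]
  have : Nontrivial (subQuot k p q) := by
    rw [Submodule.Quotient.nontrivial_iff]
    intro h
    apply hpq
    intro x hx
    have : (⟨x, hx⟩ : p) ∈ Submodule.comap p.subtype q := by rw [h]; trivial
    exact this
  rw [regSubQuot, hG, regM_le_iff K G, rb_iff_rel K G hp (Submodule.mkQ N)
    (Submodule.mkQ_surjective N) (fun x => Submodule.Quotient.mk_eq_zero N) (fun i x => rfl)]
  intro i hi m
  obtain ⟨f, rfl⟩ := Submodule.Quotient.mk_surjective N m
  change Submodule.Quotient.mk _ = _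
  rw [Submodule.Quotient.mk_eq_zero]
  change compZ k i f ∈ q
  rw [compZ_of_neg hi]
  exact zero_mem _

theorem regQuot_le_iff [Finite σ] (K : Koszul k σ) {q : Ideal (MvPolynomial σ k)}
    (hq : HomogId k q) (hq1 : q ≠ ⊤) (a : ℤ) :
    regQuot k q ≤ a ↔ ∀ d, a < d → K.Rel ⊤ q d := by
  let G : Gr k σ (MvPolynomial σ k ⧸ q) := (polyGr k σ).quot q hq
  have hG : quotGr k q = G.gr := by
    funext t
    apply le_antisymm
    · refine (AddSubgroup.closure_le _).2 ?_
      rintro _ ⟨f, hf, rfl⟩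
      change Submodule.Quotient.mk _ = Submodule.Quotient.mk _
      congr 1
      exact (homogZ_iff _ _).1 hf
    · intro x hx
      obtain ⟨f, rfl⟩ := Submodule.Quotient.mk_surjective q x
      rw [← G.mem_gr.1 hx]
      refine AddSubgroup.subset_closure ⟨compZ k t f, ?_, rfl⟩
      rw [homogZ_iff, compZ_compZ, if_pos rfl]
  have : Nontrivial (MvPolynomial σ k ⧸ q) := Ideal.Quotient.nontrivial_iff.2 hq1
  rw [regQuot, hG, regM_le_iff K G, rb_iff_rel K G homogId_top
    ((Submodule.mkQ q).comp (Submodule.subtype ⊤))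
    (fun m => by
      obtain ⟨f, rfl⟩ := Submodule.mkQ_surjective q m
      exact ⟨⟨f, trivial⟩, rfl⟩) (fun x => Submodule.Quotient.mk_eq_zero q) (fun i x => rfl)]
  intro i hi m
  obtain ⟨f, rfl⟩ := Submodule.Quotient.mk_surjective q m
  change Submodule.Quotient.mk (compZ k i f) = _
  rw [compZ_of_neg hi]
  rfl

end Relative

section Families
variable {k : Type} [Field k] {σ τ : Type}

/-- Families of polynomials with entries in an ideal. -/
def fam (S : Type) (p : Ideal (MvPolynomial σ k)) : Submodule k (S → MvPolynomial σ k) where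
  carrier := {f | ∀ t, f t ∈ p}
  add_mem' hf hg t := add_mem (hf t) (hg t)
  zero_mem' _ := zero_mem _
  smul_mem' a _ hf t := Submodule.smul_of_tower_mem p a (hf t)

theorem fam_mono (S : Type) {p q : Ideal (MvPolynomial σ k)} (h : p ≤ q) : fam S p ≤ fam S q :=
  fun _ hf t => h (hf t)

theorem fam_top (S : Type) : fam S (⊤ : Ideal (MvPolynomial σ k)) = ⊤ :=
  eq_top_iff.2 fun _ _ _ => trivial

theorem fam_sup (S : Type) (p q : Ideal (MvPolynomial σ k)) :
    fam S (p ⊔ q) = fam S p ⊔ fam S q := by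
  apply le_antisymm
  · intro f hf
    choose a ha b hb hab using fun t => Submodule.mem_sup.1 (hf t)
    exact Submodule.mem_sup.2 ⟨a, ha, b, hb, funext hab⟩
  · exact sup_le (fam_mono S le_sup_left) (fam_mono S le_sup_right)

/-- Extension of an ideal along the inclusion of the first set of variables. -/
def extL (τ : Type) (p : Ideal (MvPolynomial σ k)) : Ideal (MvPolynomial (σ ⊕ τ) k) :=
  p.map (rename (Sum.inl : σ → σ ⊕ τ))

/-- Extension of an ideal along the inclusion of the second set of variables. -/
def extR (σ : Type) (q : Ideal (MvPolynomial τ k)) : Ideal (MvPolynomial (σ ⊕ τ) k) :=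
  q.map (rename (Sum.inr : τ → σ ⊕ τ))

theorem extL_top : extL τ (⊤ : Ideal (MvPolynomial σ k)) = ⊤ := Ideal.map_top _

theorem extR_top : extR σ (⊤ : Ideal (MvPolynomial τ k)) = ⊤ := Ideal.map_top _

theorem extL_pow (p : Ideal (MvPolynomial σ k)) (n : ℕ) : extL τ (p ^ n) = extL τ p ^ n :=
  Ideal.map_pow _ _ _

theorem extR_pow (q : Ideal (MvPolynomial τ k)) (n : ℕ) : extR σ (q ^ n) = extR σ q ^ n :=
  Ideal.map_pow _ _ _

theorem mem_extL_mul_extR {p : Ideal (MvPolynomial σ k)} {q : Ideal (MvPolynomial τ k)}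
    {N : Submodule k (MvPolynomial (σ ⊕ τ) k)}
    (hN : ∀ a ∈ p, ∀ b ∈ q, rename Sum.inl a * rename Sum.inr b ∈ N)
    {x : MvPolynomial (σ ⊕ τ) k} (hx : x ∈ extL τ p * extR σ q) : x ∈ N := by
  have hN' : ∀ r : MvPolynomial (σ ⊕ τ) k, ∀ a ∈ p, ∀ b ∈ q,
      r * (rename Sum.inl a * rename Sum.inr b) ∈ N := by
    intro r a ha b hb
    induction r using MvPolynomial.induction_on' with
    | monomial e c =>
      obtain ⟨⟨u, v⟩, rfl⟩ := Finsupp.sumFinsuppEquivProdFinsupp.symm.surjective e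
      have h1 := rename_inl_monomial_mul u v c 1
      rw [mul_one] at h1
      rw [← h1, mul_mul_mul_comm, ← map_mul, ← map_mul]
      exact hN _ (Ideal.mul_mem_left _ _ ha) _ (Ideal.mul_mem_left _ _ hb)
    | add r r' hr hr' => rw [add_mul]; exact add_mem hr hr'
  rw [extL, extR, Ideal.map, Ideal.map, Ideal.span_mul_span'] at hx
  have key : ∀ r : MvPolynomial (σ ⊕ τ) k, r * x ∈ N := by
    induction hx using Submodule.span_induction with
    | mem x hx =>
      obtain ⟨_, ⟨a, ha, rfl⟩, _, ⟨b, hb, rfl⟩, rfl⟩ := hx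
      exact fun r => hN' r a ha b hb
    | zero => intro r; rw [mul_zero]; exact zero_mem _
    | add x y _ _ hx hy => intro r; rw [mul_add]; exact add_mem (hx r) (hy r)
    | smul c x _ hx =>
      intro r
      rw [smul_eq_mul, ← mul_assoc]
      exact hx _
  simpa using key 1

theorem map₂_fam (S T : Type) [Fintype S] [Fintype T] (p : Ideal (MvPolynomial σ k))
    (q : Ideal (MvPolynomial τ k)) :
    Submodule.map₂ (extMul k σ τ S T) (fam S p) (fam T q) = fam (S × T) (extL τ p * extR σ q) := by
  classical
  apply le_antisymm
  · rw [Submodule.map₂_le]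
    exact fun f hf g hg x => Ideal.mul_mem_mul (Ideal.mem_map_of_mem _ (hf _))
      (Ideal.mem_map_of_mem _ (hg _))
  · intro f hf
    have h1 : f = ∑ x, Pi.single x (f x) := (Finset.univ_sum_single f).symm
    rw [h1]
    refine sum_mem fun x _ => ?_
    refine mem_extL_mul_extR (N := (Submodule.map₂ (extMul k σ τ S T) (fam S p) (fam T q)).comap
      (LinearMap.single k (fun _ : S × T => MvPolynomial (σ ⊕ τ) k) x)) ?_ (hf x)
    intro a ha b hb
    rw [Submodule.mem_comap]
    have h2 : LinearMap.single k (fun _ : S × T => MvPolynomial (σ ⊕ τ) k) x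
        (rename Sum.inl a * rename Sum.inr b) =
        extMul k σ τ S T (Pi.single x.1 a) (Pi.single x.2 b) := by
      ext1 y
      rw [extMul_apply, LinearMap.single_apply]
      by_cases hs : y.1 = x.1
      · by_cases ht : y.2 = x.2
        · obtain rfl : y = x := Prod.ext hs ht
          simp
        · rw [Pi.single_eq_of_ne (fun h => ht (by rw [h])), Pi.single_eq_of_ne ht]
          simp
      · rw [Pi.single_eq_of_ne (fun h => hs (by rw [h])), Pi.single_eq_of_ne hs]
        simp
    rw [h2]
    refine Submodule.apply_mem_map₂ _ (fun t => ?_) (fun t => ?_)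
    · by_cases h : t = x.1
      · subst h; simpa using ha
      · rw [Pi.single_eq_of_ne h]; exact zero_mem _
    · by_cases h : t = x.2
      · subst h; simpa using hb
      · rw [Pi.single_eq_of_ne h]; exact zero_mem _

theorem map₂_inf_le {V W Z : Type} [AddCommGroup V] [AddCommGroup W] [AddCommGroup Z]
    [Module k V] [Module k W] [Module k Z] {μ : V →ₗ[k] W →ₗ[k] Z} (hμ : IsTensorProduct μ)
    (F : Submodule k V) (G : Submodule k W) :
    Submodule.map₂ μ F ⊤ ⊓ Submodule.map₂ μ ⊤ G ≤ Submodule.map₂ μ F G := by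
  obtain ⟨e, he, he'⟩ := exists_projection F
  obtain ⟨e₁, he₁, he₁'⟩ := exists_projection G
  let A : Z →ₗ[k] Z := hμ.lift (μ.compl₁₂ e LinearMap.id)
  let B : Z →ₗ[k] Z := hμ.lift (μ.compl₁₂ LinearMap.id e₁)
  have hA : ∀ v w, A (μ v w) = μ (e v) w := fun v w => hμ.lift_eq _ _ _
  have hB : ∀ v w, B (μ v w) = μ v (e₁ w) := fun v w => hμ.lift_eq _ _ _
  rintro z ⟨h1, h2⟩
  have hA' : A z = z := by
    have : Submodule.map₂ μ F ⊤ ≤ LinearMap.ker (A - LinearMap.id) := by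
      rw [Submodule.map₂_le]
      intro v hv w _
      rw [LinearMap.mem_ker, LinearMap.sub_apply, hA, he' v hv]
      simp
    simpa [sub_eq_zero] using this h1
  have hB' : B z = z := by
    have : Submodule.map₂ μ ⊤ G ≤ LinearMap.ker (B - LinearMap.id) := by
      rw [Submodule.map₂_le]
      intro v _ w hw
      rw [LinearMap.mem_ker, LinearMap.sub_apply, hB, he₁' w hw]
      simp
    simpa [sub_eq_zero] using this h2
  have h3 : ∀ z, A (B z) ∈ Submodule.map₂ μ F G := by
    intro z
    induction z using hμ.inductionOn with
    | zero => simp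
    | tmul v w =>
      rw [hB, hA]
      exact Submodule.apply_mem_map₂ _ (he v) (he₁ w)
    | add x y hx hy =>
      rw [map_add, map_add]
      exact add_mem hx hy
  rw [← hA', ← hB']
  exact h3 z

theorem extL_inf_extR_le (p : Ideal (MvPolynomial σ k)) (q : Ideal (MvPolynomial τ k)) :
    extL τ p ⊓ extR σ q ≤ extL τ p * extR σ q := by
  rintro x ⟨hp, hq⟩
  have h := map₂_inf_le (isTensorProduct_extMul k σ τ Unit Unit) (fam Unit p) (fam Unit q)
  rw [← fam_top, ← fam_top, map₂_fam, map₂_fam, map₂_fam, extL_top, extR_top, Ideal.mul_top,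
    Ideal.top_mul] at h
  exact h (x := fun _ => x) ⟨fun _ => hp, fun _ => hq⟩ ((), ())

end Families

section Kunneth
variable {k : Type} [Field k] {σ τ : Type}

/-- The homogeneous component of a family of polynomials. -/
def famC (k : Type) [Field k] {σ : Type} (S : Type) (i : ℤ) :
    (S → MvPolynomial σ k) →ₗ[k] (S → MvPolynomial σ k) := (compZ k i).compLeft S

theorem famC_apply {S : Type} (i : ℤ) (f : S → MvPolynomial σ k) (t : S) :
    famC k S i f t = compZ k i (f t) := rfl

theorem famC_famC {S : Type} (i j : ℤ) (f : S → MvPolynomial σ k) :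
    famC k S i (famC k S j f) = if i = j then famC k S j f else 0 := by
  ext1 t
  rw [famC_apply, famC_apply, compZ_compZ]
  split_ifs <;> rfl

theorem exists_sum_famC {S : Type} [Fintype S] (f : S → MvPolynomial σ k) :
    ∃ s : Finset ℤ, f = ∑ i ∈ s, famC k S i f := by
  classical
  refine ⟨Finset.univ.biUnion fun t => ((polyGr k σ).fin (f t)).toFinset, ?_⟩
  ext1 t
  rw [Finset.sum_apply]
  conv_lhs => rw [(polyGr k σ).eq_sum (f t)]
  refine Finset.sum_subset (fun i hi => Finset.mem_biUnion.2 ⟨t, Finset.mem_univ _, hi⟩) ?_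
  intro i _ hi
  simpa using hi

theorem HomogId.famC_mem {p : Ideal (MvPolynomial σ k)} (hp : HomogId k p) {S : Type} (i : ℤ)
    {f : S → MvPolynomial σ k} (hf : f ∈ fam S p) : famC k S i f ∈ fam S p :=
  fun t => hp i _ (hf t)

theorem Koszul.famC_D (K : Koszul k σ) (i : ℤ) (f : K.T → MvPolynomial σ k) :
    famC k K.T i (K.D _ f) = K.D _ (famC k K.T (i - 1) f) :=
  funext fun t => K.compZ_D i f t

theorem Koszul.D_mem (K : Koszul k σ) {p : Ideal (MvPolynomial σ k)}
    {f : K.T → MvPolynomial σ k} (hf : f ∈ fam K.T p) : K.D _ f ∈ fam K.T p :=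
  fun t => by
    rw [K.D_apply]
    exact sum_mem fun t' _ => Ideal.mul_mem_left _ _ (hf t')

theorem Koszul.even_mem (K : Koszul k σ) {p : Ideal (MvPolynomial σ k)}
    {f : K.T → MvPolynomial σ k} (hf : f ∈ fam K.T p) : K.even f ∈ fam K.T p :=
  fun t => by
    rw [K.even_apply]
    split_ifs
    · exact hf t
    · exact zero_mem _

theorem Koszul.rel_iff (K : Koszul k σ) (p q : Ideal (MvPolynomial σ k)) (d : ℤ) :
    K.Rel p q d ↔ ∀ f ∈ fam K.T p, famC k K.T d f = f → K.D _ f ∈ fam K.T q →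
      ∃ g ∈ fam K.T p, f - K.D _ g ∈ fam K.T q :=
  ⟨fun h f hf hfd hD => h f hf (congrFun hfd) hD, fun h f hf hfd hD => h f hf (funext hfd) hD⟩

/-- Families with entries in an ideal whose components of degree at most `a` vanish. -/
def highFam (S : Type) (p : Ideal (MvPolynomial σ k)) (a : ℤ) :
    Submodule k (S → MvPolynomial σ k) :=
  fam S p ⊓ ⨅ i ∈ Set.Iic a, LinearMap.ker (famC k S i)

theorem mem_highFam {S : Type} {p : Ideal (MvPolynomial σ k)} {a : ℤ}
    {f : S → MvPolynomial σ k} :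
    f ∈ highFam S p a ↔ f ∈ fam S p ∧ ∀ i ≤ a, famC k S i f = 0 := by
  simp [highFam]

theorem HomogId.famC_mem_highFam {p : Ideal (MvPolynomial σ k)} (hp : HomogId k p) {S : Type}
    {a i : ℤ} (hi : a < i) {f : S → MvPolynomial σ k} (hf : f ∈ fam S p) :
    famC k S i f ∈ highFam S p a :=
  mem_highFam.2 ⟨hp.famC_mem i hf, fun j hj => by rw [famC_famC, if_neg (by omega)]⟩

theorem Koszul.even_mem_highFam (K : Koszul k σ) {p : Ideal (MvPolynomial σ k)} {a : ℤ}
    {f : K.T → MvPolynomial σ k} (hf : f ∈ highFam K.T p a) : K.even f ∈ highFam K.T p a := by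
  rw [mem_highFam] at *
  refine ⟨K.even_mem hf.1, fun i hi => ?_⟩
  ext1 t
  rw [famC_apply, K.even_apply]
  split_ifs
  · exact congrFun (hf.2 i hi) t
  · exact map_zero _

theorem Koszul.exists_sub_mem_of_rel (K : Koszul k σ) {p q : Ideal (MvPolynomial σ k)}
    (hp : HomogId k p) (hq : HomogId k q) {a : ℤ} (h : ∀ d, a < d → K.Rel p q d)
    (f : K.T → MvPolynomial σ k) (hf : f ∈ highFam K.T p a) (hD : K.D _ f ∈ fam K.T q) :
    ∃ g ∈ fam K.T p, f - K.D _ g ∈ fam K.T q := by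
  rw [mem_highFam] at hf
  have key : ∀ i, ∃ g ∈ fam K.T p, famC k K.T i f - K.D _ g ∈ fam K.T q := by
    intro i
    by_cases hi : i ≤ a
    · exact ⟨0, zero_mem _, by rw [hf.2 i hi, map_zero, sub_zero]; exact zero_mem _⟩
    · refine (K.rel_iff p q i).1 (h i (not_le.1 hi)) _ (hp.famC_mem i hf.1)
        (by rw [famC_famC, if_pos rfl]) ?_
      have := hq.famC_mem (i + 1) hD
      rwa [K.famC_D, add_sub_cancel_right] at this
  choose g hg hfg using key
  obtain ⟨s, hs⟩ := exists_sum_famC f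
  refine ⟨∑ i ∈ s, g i, sum_mem fun i _ => hg i, ?_⟩
  rw [map_sum]
  nth_rw 1 [hs]
  rw [← Finset.sum_sub_distrib]
  exact sum_mem fun i _ => hfg i

theorem famC_extMul {S T : Type} (d i j : ℤ) (f : S → MvPolynomial σ k)
    (g : T → MvPolynomial τ k) :
    famC k (S × T) d (extMul k σ τ S T (famC k S i f) (famC k T j g)) =
      if d = i + j then extMul k σ τ S T (famC k S i f) (famC k T j g) else 0 := by
  ext1 x
  have h1 : rename Sum.inr (famC k T j g x.2) ∈ (polyGr k (σ ⊕ τ)).gr j := by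
    change compZ k j _ = _
    rw [← rename_compZ, famC_apply, compZ_compZ, if_pos rfl]
  have h2 := (polyGr k (σ ⊕ τ)).c_smul h1 (rename Sum.inl (famC k S i f x.1)) d
  rw [famC_apply, extMul_apply]
  refine h2.trans ?_
  rw [smul_eq_mul, ← rename_compZ, famC_apply, compZ_compZ]
  by_cases h : d = i + j
  · rw [if_pos h, if_pos (by omega)]
    rfl
  · rw [if_neg h, if_neg (by omega), map_zero, zero_mul]
    rfl

theorem famC_mem_map₂ {S T : Type} [Fintype S] [Fintype T] {p : Ideal (MvPolynomial σ k)}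
    {q : Ideal (MvPolynomial τ k)} (hp : HomogId k p) (hq : HomogId k q) {a b d : ℤ}
    (hd : a + b < d) {z : S × T → MvPolynomial (σ ⊕ τ) k}
    (hz : z ∈ Submodule.map₂ (extMul k σ τ S T) (fam S p) (fam T q)) :
    famC k (S × T) d z ∈ Submodule.map₂ (extMul k σ τ S T) (highFam S p a) (fam T q) ⊔
      Submodule.map₂ (extMul k σ τ S T) (fam S p) (highFam T q b) := by
  suffices h : Submodule.map₂ (extMul k σ τ S T) (fam S p) (fam T q) ≤
    Submodule.comap (famC k (S × T) d)
      (Submodule.map₂ (extMul k σ τ S T) (highFam S p a) (fam T q) ⊔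
        Submodule.map₂ (extMul k σ τ S T) (fam S p) (highFam T q b)) from h hz
  rw [Submodule.map₂_le]
  intro f hf g hg
  rw [Submodule.mem_comap]
  obtain ⟨s, hs⟩ := exists_sum_famC f
  obtain ⟨t, ht⟩ := exists_sum_famC g
  rw [hs, ht, LinearMap.map_sum₂, map_sum]
  refine sum_mem fun i _ => ?_
  rw [map_sum, map_sum]
  refine sum_mem fun j _ => ?_
  rw [famC_extMul]
  split_ifs with h
  · by_cases hi : a < i
    · exact Submodule.mem_sup_left
        (Submodule.apply_mem_map₂ _ (hp.famC_mem_highFam hi hf) (hq.famC_mem j hg))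
    · exact Submodule.mem_sup_right
        (Submodule.apply_mem_map₂ _ (hp.famC_mem i hf) (hq.famC_mem_highFam (by omega) hg))
  · exact zero_mem _

theorem Koszul.Rel.prod (K : Koszul k σ) (L : Koszul k τ) {p p' : Ideal (MvPolynomial σ k)}
    {q q' : Ideal (MvPolynomial τ k)} (hp : HomogId k p) (hp' : HomogId k p')
    (hq : HomogId k q) (hq' : HomogId k q') (hpp : p' ≤ p) (hqq : q' ≤ q) {a b : ℤ}
    (ha : ∀ d, a < d → K.Rel p p' d) (hb : ∀ d, b < d → L.Rel q q' d) {d : ℤ} (hd : a + b < d) :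
    (K.prod L).Rel (extL τ p * extR σ q) (extL τ p' * extR σ q ⊔ extL τ p * extR σ q') d := by
  have e1 : fam (K.prod L).T (extL τ p * extR σ q) =
    Submodule.map₂ (extMul k σ τ K.T L.T) (fam K.T p) (fam L.T q) := (map₂_fam _ _ _ _).symm
  have e2 : fam (K.prod L).T (extL τ p' * extR σ q ⊔ extL τ p * extR σ q') =
    Submodule.map₂ (extMul k σ τ K.T L.T) (fam K.T p') (fam L.T q) ⊔
      Submodule.map₂ (extMul k σ τ K.T L.T) (fam K.T p) (fam L.T q') := by
    rw [fam_sup, map₂_fam, map₂_fam]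
    rfl
  rw [Koszul.rel_iff, e1, e2]
  intro z hz hzd hD
  have h1 := famC_mem_map₂ (a := a) (b := b) hp hq hd hz
  exact relative_kunneth (isTensorProduct_extMul k σ τ K.T L.T)
      ((K.D (MvPolynomial σ k)).restrictScalars k) K.even
      ((L.D (MvPolynomial τ k)).restrictScalars k) L.even
      (((K.prod L).D (MvPolynomial (σ ⊕ τ) k)).restrictScalars k)
      (K.prod_D_extMul L) (K.D_D _) K.even_even K.D_even (L.D_D _) L.even_even L.D_even
      (E := highFam K.T p a) (F := fam K.T p) (F' := fam K.T p')
      (E' := highFam L.T q b) (G := fam L.T q) (G' := fam L.T q')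
      (fam_mono _ hpp) inf_le_left (fun _ h => K.D_mem h) (fun _ h => K.D_mem h)
      (fun _ h => K.even_mem_highFam h) (fun _ h => K.even_mem h) (fun _ h => K.even_mem h)
      (K.exists_sub_mem_of_rel hp hp' ha)
      (fam_mono _ hqq) inf_le_left (fun _ h => L.D_mem h) (fun _ h => L.D_mem h)
      (fun _ h => L.even_mem_highFam h) (fun _ h => L.even_mem h) (fun _ h => L.even_mem h)
      (L.exists_sub_mem_of_rel hq hq' hb) z (by rw [← hzd]; exact h1) hD

/-- Transfer along `p / (q' ⊓ p) ≃ (p ⊔ q') / q'`. -/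
theorem Koszul.Rel.sup {K : Koszul k σ} {p q q' : Ideal (MvPolynomial σ k)} {d : ℤ}
    (hp : HomogId k p) (hq' : HomogId k q') (hqq : q ≤ q') (hpq : q' ⊓ p ≤ q)
    (h : K.Rel p q d) : K.Rel (p ⊔ q') q' d := by
  rw [Koszul.rel_iff] at *
  intro f hf hfd hD
  rw [fam_sup] at hf
  obtain ⟨u, hu, v, hv, rfl⟩ := Submodule.mem_sup.1 hf
  rw [map_add] at hfd hD
  have hDu : K.D _ u ∈ fam K.T q' := by
    simpa using sub_mem hD (K.D_mem hv)
  obtain ⟨g, hg, hfg⟩ := h (famC k K.T d u) (hp.famC_mem d hu) (by rw [famC_famC, if_pos rfl])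
    (by
      have := hq'.famC_mem (d + 1) hDu
      rw [K.famC_D, add_sub_cancel_right] at this
      exact fun t => hpq ⟨this t, K.D_mem (hp.famC_mem d hu) t⟩)
  refine ⟨g, fam_mono _ le_sup_left hg, ?_⟩
  rw [← hfd, add_sub_right_comm]
  exact add_mem (fam_mono _ hqq hfg) (hq'.famC_mem d hv)

end Kunneth

section PowersOfSums
variable {k : Type} [Field k] {σ τ : Type}

theorem sup_pow_le_pow_sup_pow {R : Type} [CommRing R] (X Y : Ideal R) (i j : ℕ) :
    (X ⊔ Y) ^ (i + j + 1) ≤ X ^ (i + 1) ⊔ Y ^ (j + 1) := by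
  rw [← Submodule.add_eq_sup, add_pow, Ideal.sum_eq_sup]
  refine Finset.sup_le fun m _ => Ideal.mul_le_left.trans ?_
  by_cases h : i + 1 ≤ m
  · exact le_sup_of_le_left (Ideal.mul_le_left.trans (Ideal.pow_le_pow_right h))
  · exact le_sup_of_le_right (Ideal.mul_le_right.trans (Ideal.pow_le_pow_right (by omega)))

theorem pow_mul_pow_le_sup_pow {R : Type} [CommRing R] (X Y : Ideal R) (i j : ℕ) :
    X ^ i * Y ^ j ≤ (X ⊔ Y) ^ (i + j) := by
  rw [pow_add]
  exact Ideal.mul_mono (Ideal.pow_right_mono le_sup_left _) (Ideal.pow_right_mono le_sup_right _)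

theorem Koszul.rel_self (K : Koszul k σ) (p : Ideal (MvPolynomial σ k)) (d : ℤ) : K.Rel p p d :=
  fun _ hf _ _ => ⟨0, fun _ => zero_mem _, fun t => by
    rw [map_zero, Pi.zero_apply, sub_zero]; exact hf t⟩

theorem Koszul.rel_top_pow (K : Koszul k σ) {I : Ideal (MvPolynomial σ k)} (hI : HomogId k I)
    {n : ℕ} {a : ℕ → ℤ} (h : ∀ i < n, ∀ d, a i < d → K.Rel (I ^ i) (I ^ (i + 1)) d)
    (ha : ∀ i, i + 1 < n → a i ≤ a (i + 1)) (i : ℕ) (hi : i < n) (d : ℤ) (hd : a i < d) :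
    K.Rel ⊤ (I ^ (i + 1)) d := by
  induction i with
  | zero => simpa using h 0 hi d hd
  | succ i ih =>
    exact Koszul.Rel.trans homogId_top (hI.pow _) le_top (Ideal.pow_le_pow_right (by omega))
      (ih (by omega) ((ha i hi).trans_lt hd)) (h _ hi d hd)

theorem Koszul.rel_top_sup_pow (K : Koszul k σ) (L : Koszul k τ) {I : Ideal (MvPolynomial σ k)}
    {J : Ideal (MvPolynomial τ k)} (hI : HomogId k I) (hJ : HomogId k J) {n : ℕ} {a b : ℕ → ℤ}
    (hA : ∀ i < n, ∀ d, a i < d → K.Rel (I ^ i) (I ^ (i + 1)) d)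
    (hB : ∀ j < n, ∀ d, b j < d → L.Rel ⊤ (J ^ (j + 1)) d)
    {d : ℤ} (hd : ∀ i j, i + j + 1 = n → a i + b j < d) :
    (K.prod L).Rel ⊤ ((extL τ I ⊔ extR σ J) ^ n) d := by
  have hQ : HomogId k ((extL τ I ⊔ extR σ J) ^ n) :=
    ((hI.map_rename _).sup (hJ.map_rename _)).pow n
  have hX : ∀ t, HomogId k (extL τ I ^ t) := fun t => HomogId.pow (hI.map_rename _) t
  set Q := (extL τ I ⊔ extR σ J) ^ n with hQdef
  have key : ∀ t ≤ n, (K.prod L).Rel ⊤ (extL τ I ^ t ⊔ Q) d := by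
    intro t ht
    induction t with
    | zero =>
      rw [pow_zero, Ideal.one_eq_top, top_sup_eq]
      exact Koszul.rel_self _ _ _
    | succ t ih =>
      obtain ⟨u, rfl⟩ : ∃ u, n = t + u + 1 := ⟨n - t - 1, by omega⟩
      have hle : extL τ I ^ (t + 1) ≤ extL τ I ^ t := Ideal.pow_le_pow_right (by omega)
      refine Koszul.Rel.trans homogId_top ((hX t).sup hQ) le_top (sup_le_sup_right hle _)
        (ih (by omega)) ?_
      have h1 := Koszul.Rel.prod K L (hI.pow t) (hI.pow (t + 1)) homogId_top (hJ.pow (u + 1))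
        (Ideal.pow_le_pow_right (by omega)) le_top (hA t (by omega)) (hB u (by omega))
        (hd t u rfl)
      rw [extR_top, Ideal.mul_top, Ideal.mul_top, extL_pow, extL_pow, extR_pow] at h1
      have h2 : (K.prod L).Rel (extL τ I ^ t ⊔ (extL τ I ^ (t + 1) ⊔ Q))
          (extL τ I ^ (t + 1) ⊔ Q) d := by
        refine Koszul.Rel.sup (hX t) ((hX (t + 1)).sup hQ) ?_ ?_ h1
        · exact sup_le_sup_left (pow_mul_pow_le_sup_pow _ _ _ _) _
        · calc (extL τ I ^ (t + 1) ⊔ Q) ⊓ extL τ I ^ t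
              ≤ (extL τ I ^ (t + 1) ⊔ extR σ J ^ (u + 1)) ⊓ extL τ I ^ t :=
                inf_le_inf_right _ (sup_le le_sup_left (sup_pow_le_pow_sup_pow _ _ _ _))
            _ = extL τ I ^ (t + 1) ⊔ extR σ J ^ (u + 1) ⊓ extL τ I ^ t :=
                sup_inf_assoc_of_le _ hle
            _ ≤ _ := by
                refine sup_le_sup_left ?_ _
                rw [inf_comm, ← extL_pow, ← extR_pow]
                exact extL_inf_extR_le _ _
      rwa [← sup_assoc, sup_eq_left.2 hle] at h2
  have h := key n le_rfl
  rwa [sup_eq_right.2 (Ideal.pow_right_mono le_sup_left n)] at h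

/-- A nontrivial Koszul homology class of `p / p'` surviving in the homology of the quotient by
`p'` is detected by a linear functional. -/
theorem Koszul.exists_functional (K : Koszul k σ) {p p' : Ideal (MvPolynomial σ k)}
    (hp' : HomogId k p') (hpp : p' ≤ p) {a : ℤ} (h : ¬ K.Rel p p' a)
    (h' : K.Rel ⊤ p (a - 1)) :
    ∃ z ∈ fam K.T p, famC k K.T a z = z ∧ K.D _ z ∈ fam K.T p' ∧
      ∃ φ : (K.T → MvPolynomial σ k) →ₗ[k] k, φ z ≠ 0 ∧ (∀ g, φ (K.D _ g) = 0) ∧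
        ∀ f ∈ fam K.T p', φ f = 0 := by
  rw [Koszul.rel_iff] at h h'
  push Not at h
  obtain ⟨z, hz, hza, hD, hzg⟩ := h
  refine ⟨z, hz, hza, hD, ?_⟩
  have hn : z ∉ LinearMap.range ((K.D (MvPolynomial σ k)).restrictScalars k) ⊔ fam K.T p' := by
    intro hmem
    obtain ⟨_, ⟨g, rfl⟩, f, hf, hgf⟩ := Submodule.mem_sup.1 hmem
    rw [LinearMap.restrictScalars_apply] at hgf
    have h1 : K.D _ (famC k K.T (a - 1) g) + famC k K.T a f = z := by
      rw [← K.famC_D, ← map_add, hgf, hza]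
    have hf' := hp'.famC_mem a hf
    obtain ⟨w, -, hw⟩ := h' (famC k K.T (a - 1) g) (fun _ => trivial)
      (by rw [famC_famC, if_pos rfl])
      (by rw [eq_sub_of_add_eq h1]; exact sub_mem hz (fam_mono _ hpp hf'))
    refine hzg _ hw ?_
    rw [map_sub, K.D_D, sub_zero, ← h1, add_sub_cancel_left]
    exact hf'
  obtain ⟨φ, hφ, hle⟩ := Submodule.exists_le_ker_of_notMem hn
  exact ⟨φ, hφ, fun g => hle (Submodule.mem_sup_left ⟨g, rfl⟩),
    fun f hf => hle (Submodule.mem_sup_right hf)⟩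

theorem Koszul.not_rel_top (K : Koszul k σ) (L : Koszul k τ) {p p' : Ideal (MvPolynomial σ k)}
    {q q' : Ideal (MvPolynomial τ k)} (hp' : HomogId k p') (hpp : p' ≤ p)
    (hq' : HomogId k q') (hqq : q' ≤ q) {a b : ℤ}
    (ha : ¬ K.Rel p p' a) (ha' : K.Rel ⊤ p (a - 1)) (hb : ¬ L.Rel q q' b)
    (hb' : L.Rel ⊤ q (b - 1)) {Q : Ideal (MvPolynomial (σ ⊕ τ) k)}
    (h₁ : extL τ p' * extR σ q ≤ Q) (h₂ : extL τ p * extR σ q' ≤ Q)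
    (h₃ : Q ≤ extL τ p' ⊔ extR σ q') : ¬ (K.prod L).Rel ⊤ Q (a + b) := by
  obtain ⟨z, hz, hza, hDz, φ, hφz, hφD, hφ⟩ := K.exists_functional hp' hpp ha ha'
  obtain ⟨w, hw, hwb, hDw, ψ, hψw, hψD, hψ⟩ := L.exists_functional hq' hqq hb hb'
  let Φ : ((K.prod L).T → MvPolynomial (σ ⊕ τ) k) →ₗ[k] k :=
    (isTensorProduct_extMul k σ τ K.T L.T).lift ((LinearMap.mul k k).compl₁₂ φ ψ)
  have hΦ : ∀ f g, Φ (extMul k σ τ K.T L.T f g) = φ f * ψ g :=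
    fun f g => (isTensorProduct_extMul k σ τ K.T L.T).lift_eq _ _ _
  have hΦD : ∀ y, Φ ((K.prod L).D _ y) = 0 := by
    intro y
    induction y using (isTensorProduct_extMul k σ τ K.T L.T).inductionOn with
    | zero => exact (congrArg Φ (map_zero ((K.prod L).D _))).trans (map_zero Φ)
    | tmul f g =>
      refine (congrArg Φ (K.prod_D_extMul L f g)).trans ((map_add Φ _ _).trans ?_)
      refine (congrArg₂ _ (hΦ _ _) (hΦ _ _)).trans ?_
      rw [hφD, hψD, zero_mul, mul_zero, add_zero]
    | add x y hx hy =>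
      exact (congrArg Φ (map_add ((K.prod L).D _) x y)).trans ((map_add Φ _ _).trans
        ((congrArg₂ _ hx hy).trans (add_zero 0)))
  have hΦQ : fam (K.prod L).T Q ≤ LinearMap.ker Φ := by
    have e : fam (K.T × L.T) (extL τ p' ⊔ extR σ q') =
        Submodule.map₂ (extMul k σ τ K.T L.T) (fam K.T p') (fam L.T ⊤) ⊔
          Submodule.map₂ (extMul k σ τ K.T L.T) (fam K.T ⊤) (fam L.T q') := by
      rw [map₂_fam, map₂_fam, fam_sup, extR_top, extL_top, Ideal.mul_top, Ideal.top_mul]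
    refine (fam_mono _ h₃).trans (e.le.trans ?_)
    refine sup_le (Submodule.map₂_le.2 fun f hf g _ => ?_)
      (Submodule.map₂_le.2 fun f _ g hg => ?_)
    · exact (hΦ f g).trans (by rw [hφ f hf, zero_mul])
    · exact (hΦ f g).trans (by rw [hψ g hg, mul_zero])
  intro h
  rw [Koszul.rel_iff] at h
  obtain ⟨g, -, hg⟩ := h (extMul k σ τ K.T L.T z w) (fun _ => trivial)
    (by
      have := famC_extMul (a + b) a b z w
      rwa [hza, hwb, if_pos rfl] at this)
    (by
      rw [K.prod_D_extMul]
      refine add_mem (fam_mono _ h₁ ?_) (fam_mono _ h₂ ?_)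
      · exact (map₂_fam K.T L.T p' q).le (Submodule.apply_mem_map₂ _ hDz hw)
      · refine (map₂_fam K.T L.T p q').le (Submodule.apply_mem_map₂ _ ?_ hDw)
        exact sub_mem (add_mem (K.even_mem hz) (K.even_mem hz)) hz)
  have h1 := (map_sub Φ _ _).symm.trans (LinearMap.mem_ker.1 (hΦQ hg))
  rw [hΦD, sub_zero, hΦ] at h1
  exact mul_ne_zero hφz hψw h1

theorem not_pow_le_pow_succ {R : Type} [CommRing R] [IsDomain R] [IsNoetherianRing R] {I : Ideal R}
    (h0 : I ≠ ⊥) (h1 : I ≠ ⊤) (i : ℕ) : ¬ I ^ i ≤ I ^ (i + 1) := by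
  intro h
  have key : ∀ m, I ^ i ≤ I ^ m := by
    intro m
    induction m with
    | zero => simp
    | succ m ih =>
      calc I ^ i ≤ I ^ (i + 1) := h
        _ = I ^ i * I := pow_succ _ _
        _ ≤ I ^ m * I := Ideal.mul_mono_left ih
        _ = I ^ (m + 1) := (pow_succ _ _).symm
  have h2 : I ^ i ≤ ⊥ := by
    rw [← Ideal.iInf_pow_eq_bot_of_isDomain I h1]
    exact le_iInf key
  exact pow_ne_zero i h0 (le_bot_iff.1 h2)

theorem HomogId.le_ker_constantCoeff {p : Ideal (MvPolynomial σ k)} (hp : HomogId k p)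
    (h1 : p ≠ ⊤) : p ≤ RingHom.ker (constantCoeff : MvPolynomial σ k →+* k) := by
  intro f hf
  rw [RingHom.mem_ker]
  by_contra h0
  refine h1 (Ideal.eq_top_of_isUnit_mem _ (hp 0 f hf) ?_)
  rw [compZ, if_pos le_rfl, Int.toNat_zero, homogeneousComponent_zero, ← constantCoeff_eq]
  exact (IsUnit.mk0 _ h0).map C

end PowersOfSums

section Main
variable {k : Type} [Field k] {σ : Type}

theorem sumIJ_pow_ne_top {r s : ℕ} {I : Ideal (PA k r)} {J : Ideal (PB k s)}
    (hI : HomogId k I) (hJ : HomogId k J) (hI1 : I ≠ ⊤) (hJ1 : J ≠ ⊤) {n : ℕ} (hn : n ≠ 0) :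
    (extL (Fin s) I ⊔ extR (Fin r) J) ^ n ≠ ⊤ := by
  have hle : extL (Fin s) I ⊔ extR (Fin r) J ≤
      RingHom.ker (constantCoeff : MvPolynomial (Fin r ⊕ Fin s) k →+* k) := by
    refine sup_le (Ideal.map_le_iff_le_comap.2 fun f hf => ?_)
      (Ideal.map_le_iff_le_comap.2 fun f hf => ?_)
    · rw [Ideal.mem_comap, RingHom.mem_ker, constantCoeff_rename]
      exact hI.le_ker_constantCoeff hI1 hf
    · rw [Ideal.mem_comap, RingHom.mem_ker, constantCoeff_rename]
      exact hJ.le_ker_constantCoeff hJ1 hf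
  intro h
  exact RingHom.ker_ne_top _ (top_le_iff.1 (h ▸ (Ideal.pow_le_self hn).trans hle))

theorem rel_bounds [Finite σ] (K : Koszul k σ) {I : Ideal (MvPolynomial σ k)} (hI : HomogId k I)
    (hI0 : I ≠ ⊥) (hI1 : I ≠ ⊤) {n : ℕ}
    (hIr : ∀ i : ℕ, 1 ≤ i → i ≤ n - 1 →
      regSubQuot k (I ^ (i - 1)) (I ^ i) + 2 ≤ regSubQuot k (I ^ i) (I ^ (i + 1))) :
    (∀ i, ∀ d, regSubQuot k (I ^ i) (I ^ (i + 1)) < d → K.Rel (I ^ i) (I ^ (i + 1)) d) ∧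
    (∀ i, ¬ K.Rel (I ^ i) (I ^ (i + 1)) (regSubQuot k (I ^ i) (I ^ (i + 1)))) ∧
    (∀ i < n, ∀ d, regSubQuot k (I ^ i) (I ^ (i + 1)) < d → K.Rel ⊤ (I ^ (i + 1)) d) ∧
    ∀ i < n, K.Rel ⊤ (I ^ i) (regSubQuot k (I ^ i) (I ^ (i + 1)) - 1) := by
  have hiff := fun i => regSubQuot_le_iff K (hI.pow i) (hI.pow (i + 1))
    (not_pow_le_pow_succ hI0 hI1 i)
  have h1 : ∀ i, ∀ d, regSubQuot k (I ^ i) (I ^ (i + 1)) < d → K.Rel (I ^ i) (I ^ (i + 1)) d :=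
    fun i => (hiff i _).1 le_rfl
  have h2 : ∀ i < n, ∀ d, regSubQuot k (I ^ i) (I ^ (i + 1)) < d → K.Rel ⊤ (I ^ (i + 1)) d :=
    K.rel_top_pow hI (fun i _ => h1 i) fun i hi => by
      have := hIr (i + 1) (by omega) (by omega)
      rw [Nat.add_sub_cancel] at this
      omega
  refine ⟨h1, fun i h => ?_, h2, fun i hi => ?_⟩
  · have := (hiff i (regSubQuot k (I ^ i) (I ^ (i + 1)) - 1)).2 fun d hd => by
      rcases (Int.sub_one_lt_iff.1 hd).eq_or_lt with h' | h'
      · exact h' ▸ h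
      · exact h1 i d h'
    omega
  · cases i with
    | zero => simpa using K.rel_self ⊤ _
    | succ i =>
      have := hIr (i + 1) (by omega) (by omega)
      rw [Nat.add_sub_cancel] at this
      exact h2 i (by omega) _ (by omega)

end Main

end

end PaperHTT

open PaperHTT in
/-- Corollary 3.6(ii): if `reg I^(i-1)/I^i + 2 ≤ reg I^i/I^(i+1)` for `1 ≤ i ≤ n-1`, and
likewise for `J`, then
`reg R/(I+J)^n = max_(i+j=n-1) (reg I^i/I^(i+1) + reg J^j/J^(j+1))`. -/
theorem reg_quot_power_sum_eq_of_increasing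
    (k : Type) [Field k] (r s : ℕ)
    (I : Ideal (PA k r)) (J : Ideal (PB k s))
    (hI0 : I ≠ ⊥) (hI1 : I ≠ ⊤) (hIh : IsHomogeneousIdeal k I)
    (hJ0 : J ≠ ⊥) (hJ1 : J ≠ ⊤) (hJh : IsHomogeneousIdeal k J)
    (n : ℕ) (hn : 1 ≤ n)
    (hIr : ∀ i : ℕ, 1 ≤ i → i ≤ n - 1 →
      regSubQuot k (I ^ (i - 1)) (I ^ i) + 2 ≤ regSubQuot k (I ^ i) (I ^ (i + 1)))
    (hJr : ∀ i : ℕ, 1 ≤ i → i ≤ n - 1 →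
      regSubQuot k (J ^ (i - 1)) (J ^ i) + 2 ≤ regSubQuot k (J ^ i) (J ^ (i + 1))) :
    regQuot k ((sumIJ k I J) ^ n) =
      sSup {v : ℤ | ∃ i j : ℕ, i + j = n - 1 ∧
        v = regSubQuot k (I ^ i) (I ^ (i + 1)) + regSubQuot k (J ^ j) (J ^ (j + 1))} := by
  obtain ⟨K⟩ := nonempty_koszul k r
  obtain ⟨L⟩ := nonempty_koszul k s
  have hI := homogId_of_isHomogeneousIdeal hIh
  have hJ := homogId_of_isHomogeneousIdeal hJh
  obtain ⟨hA, hA', hAt, hAt'⟩ := rel_bounds K hI hI0 hI1 hIr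
  obtain ⟨hB, hB', hBt, hBt'⟩ := rel_bounds L hJ hJ0 hJ1 hJr
  have hsum : sumIJ k I J = extL (Fin s) I ⊔ extR (Fin r) J := rfl
  rw [hsum]
  have hQ : HomogId k ((extL (Fin s) I ⊔ extR (Fin r) J) ^ n) :=
    ((hI.map_rename _).sup (hJ.map_rename _)).pow n
  have hiff := regQuot_le_iff (K.prod L) hQ (sumIJ_pow_ne_top hI hJ hI1 hJ1 (by omega))
  set S := {v : ℤ | ∃ i j : ℕ, i + j = n - 1 ∧
    v = regSubQuot k (I ^ i) (I ^ (i + 1)) + regSubQuot k (J ^ j) (J ^ (j + 1))} with hS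
  have hfin : S.Finite := by
    refine ((Finset.HasAntidiagonal.antidiagonal (n - 1)).finite_toSet.image fun x : ℕ × ℕ =>
      regSubQuot k (I ^ x.1) (I ^ (x.1 + 1)) + regSubQuot k (J ^ x.2) (J ^ (x.2 + 1))).subset ?_
    rintro _ ⟨i, j, hij, rfl⟩
    exact ⟨(i, j), by simpa using hij, rfl⟩
  apply le_antisymm
  · refine (hiff _).2 fun d hd => K.rel_top_sup_pow L hI hJ (fun i _ => hA i) hBt ?_
    exact fun i j hij => (le_csSup hfin.bddAbove ⟨i, j, by omega, rfl⟩).trans_lt hd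
  · refine csSup_le ⟨_, 0, n - 1, by omega, rfl⟩ ?_
    rintro _ ⟨i, j, hij, rfl⟩
    by_contra! hlt
    obtain rfl : n = i + j + 1 := by omega
    refine K.not_rel_top L (hI.pow (i + 1)) (Ideal.pow_le_pow_right (by omega)) (hJ.pow (j + 1))
      (Ideal.pow_le_pow_right (by omega)) (hA' i) (hAt' i (by omega)) (hB' j) (hBt' j (by omega))
      ?_ ?_ ?_ ((hiff _).1 le_rfl _ hlt)
    · rw [extL_pow, extR_pow, show i + j + 1 = i + 1 + j by omega]
      exact pow_mul_pow_le_sup_pow _ _ _ _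
    · rw [extL_pow, extR_pow]
      exact pow_mul_pow_le_sup_pow _ _ _ _
    · rw [extL_pow, extR_pow]
      exact sup_pow_le_pow_sup_pow _ _ _ _
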